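/- arXiv:2506.03480 — 2 statements merged into one kernel-verified Lean document; each statement's English description precedes it below -/
import Mathlib

section
/- The path $P_n$ with $n \geq 2$ enjoys the strong exchange property if and only if $2 \leq n \leq 6$. -/
open Finset

/-- A monomial with exponent vector `a` belongs to the `q`-th power of the edge ideal of `G`:
it is divisible by a product of `q` edges of `G`. -/
def memPow {n : ℕ} (G : SimpleGraph (Fin n)) (q : ℕ) (a : Fin n → ℕ) : Prop :=
  ∃ e : Fin q → Fin n × Fin n, (∀ i, G.Adj (e i).1 (e i).2) ∧
    ∀ j, (∑ i, ((if (e i).1 = j then 1 else 0) + (if (e i).2 = j then 1 else 0))) ≤ a j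

/-- The exponent vector `a` is componentwise bounded by `c`. -/
def bdd {n : ℕ} (c a : Fin n → ℕ) : Prop := ∀ i, a i ≤ c i

/-- `δ_c(I(G))`: the largest `q` such that `(I(G)^q)_c ≠ 0`, i.e. such that some
`c`-bounded monomial lies in `I(G)^q`. -/
noncomputable def deltaC {n : ℕ} (G : SimpleGraph (Fin n)) (c : Fin n → ℕ) : ℕ :=
  sSup {q | ∃ a, bdd c a ∧ memPow G q a}

/-- `W(c,G)`: the minimal monomial generators of `(I(G)^{δ_c(I(G))})_c`, i.e. the
`c`-bounded monomials of `I(G)^{δ_c}` that are minimal with respect to divisibility. -/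
def genW {n : ℕ} (G : SimpleGraph (Fin n)) (c : Fin n → ℕ) : Set (Fin n → ℕ) :=
  {a | bdd c a ∧ memPow G (deltaC G c) a ∧
    ∀ b, bdd a b → memPow G (deltaC G c) b → b = a}

/-- The monomial `x_ρ · u / x_ξ`. -/
def exch {n : ℕ} (u : Fin n → ℕ) (ξ ρ : Fin n) : Fin n → ℕ :=
  fun i => if i = ρ then u i + 1 else if i = ξ then u i - 1 else u i

/-- `W(c,G)` enjoys the strong exchange property. -/
def SEPc {n : ℕ} (G : SimpleGraph (Fin n)) (c : Fin n → ℕ) : Prop :=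
  ∀ u ∈ genW G c, ∀ v ∈ genW G c, ∀ ξ ρ : Fin n, v ξ < u ξ → u ρ < v ρ →
    exch u ξ ρ ∈ genW G c

/-- The graph `G` enjoys the strong exchange property: `W(c,G)` does, for every
`c ∈ ℤ_{>0}^n`. -/
def SEP {n : ℕ} (G : SimpleGraph (Fin n)) : Prop :=
  ∀ c : Fin n → ℕ, (∀ i, 0 < c i) → SEPc G c

/-- The cycle graph on `Fin m`. -/
def cycleG (m : ℕ) : SimpleGraph (Fin m) :=
  SimpleGraph.fromRel (fun i j => (i.val + 1) % m = j.val)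

/-- The path graph on `Fin m`. -/
def pathG (m : ℕ) : SimpleGraph (Fin m) :=
  SimpleGraph.fromRel (fun i j => i.val + 1 = j.val)

/-- A set of monomials is of Veronese type: it equals `w · V^{(d)}(a)`, the set of
translates by a fixed monomial `w` of all monomials of degree `d` componentwise
bounded by `a`. -/
def IsVeronese {n : ℕ} (S : Set (Fin n → ℕ)) : Prop :=
  ∃ (w : Fin n → ℕ) (d : ℕ) (a : Fin n → ℕ), d ≤ ∑ i, a i ∧
    S = {u | ∃ v : Fin n → ℕ, (∀ i, v i ≤ a i) ∧ (∑ i, v i) = d ∧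
      u = fun i => w i + v i}

/-- The graph on `Fin m` with edges given by a list of (0-based) pairs. -/
def listGraph (m : ℕ) (E : List (ℕ × ℕ)) : SimpleGraph (Fin m) :=
  SimpleGraph.fromRel (fun i j => (i.val, j.val) ∈ E)

section EdgePowers

variable {n : ℕ} {G : SimpleGraph (Fin n)}

lemma memPow_zero (a : Fin n → ℕ) : memPow G 0 a :=
  ⟨fun i => i.elim0, fun i => i.elim0, by simp⟩

lemma memPow_succ {q : ℕ} {a : Fin n → ℕ} :
    memPow G (q + 1) a ↔ ∃ x y b, G.Adj x y ∧ memPow G q b ∧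
      ∀ j, (if x = j then 1 else 0) + (if y = j then 1 else 0) + b j ≤ a j := by
  constructor
  · rintro ⟨e, he, hs⟩
    refine ⟨(e 0).1, (e 0).2, _, he 0,
      ⟨fun i => e i.succ, fun i => he _, fun j => le_rfl⟩, fun j => ?_⟩
    have := hs j
    rwa [Fin.sum_univ_succ] at this
  · rintro ⟨x, y, b, hxy, ⟨e, he, hs⟩, h⟩
    refine ⟨Fin.cons (x, y) e, fun i => ?_, fun j => ?_⟩
    · refine Fin.cases ?_ (fun i => ?_) i
      · simpa using hxy
      · simpa using he i
    · rw [Fin.sum_univ_succ]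
      simp only [Fin.cons_zero, Fin.cons_succ]
      exact (Nat.add_le_add_left (hs j) _).trans (h j)

/-- Weak duality: a weight that is at least `k` on every edge bounds the power. -/
lemma memPow.mul_le_sum {k : ℕ} {w : Fin n → ℕ} (hw : ∀ x y, G.Adj x y → k ≤ w x + w y)
    {q : ℕ} {a : Fin n → ℕ} (h : memPow G q a) : k * q ≤ ∑ j, w j * a j := by
  induction q generalizing a with
  | zero => simp
  | succ q ih =>
    obtain ⟨x, y, b, hxy, hb, hle⟩ := memPow_succ.1 h
    calc k * (q + 1) ≤ w x + w y + ∑ j, w j * b j := by linarith [ih hb, hw x y hxy]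
      _ = ∑ j, w j * ((if x = j then 1 else 0) + (if y = j then 1 else 0) + b j) := by
        simp [mul_add, Finset.sum_add_distrib]
      _ ≤ _ := Finset.sum_le_sum fun j _ => Nat.mul_le_mul_left _ (hle j)

lemma memPow.two_mul_le_sum {q : ℕ} {a : Fin n → ℕ} (h : memPow G q a) :
    2 * q ≤ ∑ j, a j := by
  simpa using h.mul_le_sum (k := 2) (w := fun _ => 1) (by simp)

lemma memPow.exists_sum_eq {q : ℕ} {a : Fin n → ℕ} (h : memPow G q a) :
    ∃ b, bdd a b ∧ memPow G q b ∧ ∑ j, b j = 2 * q := by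
  obtain ⟨e, he, hs⟩ := h
  refine ⟨_, hs, ⟨e, he, fun j => le_rfl⟩, ?_⟩
  rw [Finset.sum_comm]
  simp [Finset.sum_add_distrib]
  ring

lemma le_deltaC {c a : Fin n → ℕ} {q : ℕ} (hb : bdd c a) (h : memPow G q a) :
    q ≤ deltaC G c := by
  refine le_csSup ⟨∑ j, c j, ?_⟩ ⟨a, hb, h⟩
  rintro p ⟨b, hb, hp⟩
  have h1 := hp.two_mul_le_sum
  have h2 : ∑ j, b j ≤ ∑ j, c j := Finset.sum_le_sum fun j _ => hb j
  omega

lemma mem_genW_iff {c a : Fin n → ℕ} :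
    a ∈ genW G c ↔ bdd c a ∧ memPow G (deltaC G c) a ∧ ∑ j, a j = 2 * deltaC G c := by
  constructor
  · rintro ⟨h1, h2, h3⟩
    obtain ⟨b, hb, hp, hs⟩ := h2.exists_sum_eq
    obtain rfl := h3 b hb hp
    exact ⟨h1, h2, hs⟩
  · rintro ⟨h1, h2, h3⟩
    refine ⟨h1, h2, fun b hb hp => ?_⟩
    have hsum : ∑ j, b j = ∑ j, a j :=
      le_antisymm (Finset.sum_le_sum fun j _ => hb j) (h3 ▸ hp.two_mul_le_sum)
    exact funext fun j => (Finset.sum_eq_sum_iff_of_le fun i _ => hb i).1 hsum j (mem_univ j)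

end EdgePowers

section Path

variable {n : ℕ}

lemma pathG_adj {x y : Fin n} :
    (pathG n).Adj x y ↔ x.val + 1 = y.val ∨ y.val + 1 = x.val := by
  simp only [pathG, SimpleGraph.fromRel_adj, ne_eq, Fin.ext_iff]
  omega

/-- The degree at `j` of the multigraph with `m k` copies of the edge `{k, k + 1}`. -/
def pathDeg (m : ℕ → ℕ) (j : ℕ) : ℕ := m j + if j = 0 then 0 else m (j - 1)

lemma memPow_pathG_iff {q : ℕ} {a : Fin n → ℕ} :
    memPow (pathG n) q a ↔ ∃ m : ℕ → ℕ, (∀ k, n ≤ k + 1 → m k = 0) ∧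
      ∑ k ∈ range n, m k = q ∧ ∀ j : Fin n, pathDeg m j ≤ a j := by
  induction q generalizing a with
  | zero =>
    exact ⟨fun _ => ⟨fun _ => 0, by simp [pathDeg]⟩, fun _ => memPow_zero a⟩
  | succ q ih =>
    rw [memPow_succ]
    constructor
    · rintro ⟨x, y, b, hxy, hb, hle⟩
      obtain ⟨m, h0, hs, hd⟩ := ih.1 hb
      rw [pathG_adj] at hxy
      refine ⟨fun i => m i + if i = min x.val y.val then 1 else 0, fun k hk => ?_, ?_,
        fun j => ?_⟩
      · have := h0 k hk
        have := x.2
        have := y.2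
        simp only
        split_ifs <;> omega
      · rw [Finset.sum_add_distrib, hs, Finset.sum_ite_eq', if_pos]
        simp
      · have h1 := hle j
        have h2 := hd j
        simp only [pathDeg, Fin.ext_iff] at *
        split_ifs at * <;> omega
    · rintro ⟨m, h0, hs, hd⟩
      obtain ⟨k, hk, hmk⟩ : ∃ k ∈ range n, m k ≠ 0 := by
        by_contra! h
        rw [Finset.sum_eq_zero h] at hs
        omega
      have hkn : k + 1 < n := by
        by_contra h
        exact hmk (h0 k (by omega))
      have hm : m = fun i => (m i - if i = k then 1 else 0) + if i = k then 1 else 0 := by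
        funext i
        split_ifs with h
        · subst h; omega
        · rfl
      refine ⟨⟨k, by omega⟩, ⟨k + 1, hkn⟩,
        fun j => pathDeg (fun i => m i - if i = k then 1 else 0) j, pathG_adj.2 (Or.inl rfl),
        ih.2 ⟨fun i => m i - if i = k then 1 else 0, fun i hi => by simp [h0 i hi], ?_,
          fun j => le_rfl⟩, fun j => ?_⟩
      · have h1 : ∑ i ∈ range n, m i =
            ∑ i ∈ range n, ((m i - if i = k then 1 else 0) + if i = k then 1 else 0) :=
          Finset.sum_congr rfl fun i _ => congrFun hm i
        rw [Finset.sum_add_distrib, Finset.sum_ite_eq', if_pos hk] at h1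
        change ∑ i ∈ range n, (m i - if i = k then 1 else 0) = q
        omega
      · have h2 := hd j
        refine le_trans (le_of_eq ?_) h2
        simp only [pathDeg, Fin.ext_iff]
        have : ∀ i, i = k → m i ≠ 0 := by rintro _ rfl; exact hmk
        have h3 := this j.val
        have h4 := this (j.val - 1)
        split_ifs <;> omega

lemma sum_pathDeg {m : ℕ → ℕ} (h0 : ∀ k, n ≤ k + 1 → m k = 0) :
    ∑ j : Fin n, pathDeg m j = 2 * ∑ k ∈ range n, m k := by
  cases n with
  | zero => simp
  | succ N =>
    rw [Fin.sum_univ_eq_sum_range (fun j => pathDeg m j)]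
    simp only [pathDeg]
    rw [Finset.sum_add_distrib, Finset.sum_range_succ' (fun j => if j = 0 then 0 else m (j - 1)),
      Finset.sum_range_succ, h0 N le_rfl]
    simp
    ring

/-- Extension of an exponent vector by zero. -/
def padZero (a : Fin n → ℕ) (i : ℕ) : ℕ := if h : i < n then a ⟨i, h⟩ else 0

lemma padZero_val (a : Fin n → ℕ) (i : Fin n) : padZero a i = a i := by
  simp [padZero]

lemma padZero_of_le (a : Fin n → ℕ) {i : ℕ} (h : n ≤ i) : padZero a i = 0 := by
  simp [padZero, h]

lemma memPow_pathG_iff_of_le_six (hn : n ≤ 6) {q : ℕ} {a : Fin n → ℕ} :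
    memPow (pathG n) q a ↔ ∃ p₀ p₁ p₂ p₃ p₄ : ℕ, p₀ + p₁ + p₂ + p₃ + p₄ = q ∧
      p₀ ≤ padZero a 0 ∧ p₀ + p₁ ≤ padZero a 1 ∧ p₁ + p₂ ≤ padZero a 2 ∧
      p₂ + p₃ ≤ padZero a 3 ∧ p₃ + p₄ ≤ padZero a 4 ∧ p₄ ≤ padZero a 5 := by
  have key : ∀ m : ℕ → ℕ, (∀ k, n ≤ k → m k = 0) →
      ∑ k ∈ range n, m k = m 0 + m 1 + m 2 + m 3 + m 4 + m 5 := by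
    intro m h0
    rw [Finset.sum_subset (Finset.range_subset_range.2 hn)
      (fun k _ hk => h0 k (by simpa using hk))]
    simp [Finset.sum_range_succ]
  rw [memPow_pathG_iff]
  constructor
  · rintro ⟨m, h0, hs, hd⟩
    rw [key m fun k hk => h0 k (by omega)] at hs
    have hd' : ∀ j, pathDeg m j ≤ padZero a j := by
      intro j
      by_cases hj : j < n
      · simpa [padZero, hj] using hd ⟨j, hj⟩
      · have h1 := h0 j (by omega)
        have h2 := h0 (j - 1) (by omega)
        simp [pathDeg, h1, h2]
    have h5 := h0 5 (by omega)
    have d0 := hd' 0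
    have d1 := hd' 1
    have d2 := hd' 2
    have d3 := hd' 3
    have d4 := hd' 4
    have d5 := hd' 5
    simp only [pathDeg] at d0 d1 d2 d3 d4 d5
    norm_num at d0 d1 d2 d3 d4 d5
    exact ⟨m 0, m 1, m 2, m 3, m 4, by omega, by omega, by omega, by omega, by omega, by omega,
      by omega⟩
  · rintro ⟨p₀, p₁, p₂, p₃, p₄, hs, h0, h1, h2, h3, h4, h5⟩
    have hz : ∀ i, n ≤ i → padZero a i = 0 := fun i => padZero_of_le a
    let m : ℕ → ℕ := fun k => if k = 0 then p₀ else if k = 1 then p₁ else if k = 2 then p₂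
      else if k = 3 then p₃ else if k = 4 then p₄ else 0
    have hm : ∀ k, n ≤ k + 1 → m k = 0 := by
      intro k hk
      have hz' := hz (k + 1) hk
      simp only [m]
      split_ifs with e0 e1 e2 e3 e4
      · subst e0; simp only [zero_add] at hz'; omega
      · subst e1; norm_num at hz'; omega
      · subst e2; norm_num at hz'; omega
      · subst e3; norm_num at hz'; omega
      · subst e4; norm_num at hz'; omega
      · rfl
    refine ⟨m, hm, ?_, ?_⟩
    · rw [key m fun k hk => hm k (by omega)]
      simp [m, hs]
    · intro j
      rw [← padZero_val a j]
      obtain ⟨j, hj⟩ := j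
      have : j < 6 := by omega
      simp only
      interval_cases j <;> simp [pathDeg, m] <;> omega

lemma sum_eq_padZero (hn : n ≤ 6) (a : Fin n → ℕ) :
    ∑ j, a j = padZero a 0 + padZero a 1 + padZero a 2 + padZero a 3 + padZero a 4
      + padZero a 5 := by
  simp_rw [← padZero_val a]
  rw [Fin.sum_univ_eq_sum_range (fun j => padZero a j),
    Finset.sum_subset (Finset.range_subset_range.2 hn)
      (fun k _ hk => padZero_of_le a (by simpa using hk))]
  simp [Finset.sum_range_succ]

/-- Strong duality on six vertices: some feasible edge multiplicities attain the total
capacity of a minimal vertex cover of the path. -/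
lemma exists_matching_eq_cover (c₀ c₁ c₂ c₃ c₄ c₅ : ℕ) :
    ∃ p₀ p₁ p₂ p₃ p₄ : ℕ, (p₀ ≤ c₀ ∧ p₀ + p₁ ≤ c₁ ∧ p₁ + p₂ ≤ c₂ ∧
      p₂ + p₃ ≤ c₃ ∧ p₃ + p₄ ≤ c₄ ∧ p₄ ≤ c₅) ∧
      (p₀ + p₁ + p₂ + p₃ + p₄ = c₁ + c₃ + c₅ ∨ p₀ + p₁ + p₂ + p₃ + p₄ = c₁ + c₃ + c₄ ∨
       p₀ + p₁ + p₂ + p₃ + p₄ = c₁ + c₂ + c₄ ∨ p₀ + p₁ + p₂ + p₃ + p₄ = c₀ + c₂ + c₄ ∨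
       p₀ + p₁ + p₂ + p₃ + p₄ = c₀ + c₂ + c₃ + c₅) := by
  obtain ⟨p₀, h0⟩ : ∃ p, p = min c₀ c₁ := ⟨_, rfl⟩
  obtain ⟨p₁, h1⟩ : ∃ p, p = min (c₁ - p₀) c₂ := ⟨_, rfl⟩
  obtain ⟨p₂, h2⟩ : ∃ p, p = min (c₂ - p₁) c₃ := ⟨_, rfl⟩
  obtain ⟨p₃, h3⟩ : ∃ p, p = min (c₃ - p₂) c₄ := ⟨_, rfl⟩
  obtain ⟨p₄, h4⟩ : ∃ p, p = min (c₄ - p₃) c₅ := ⟨_, rfl⟩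
  exact ⟨p₀, p₁, p₂, p₃, p₄, by omega, by omega⟩

lemma padZero_exch (u : Fin n → ℕ) (ξ ρ : Fin n) (i : ℕ) :
    padZero (exch u ξ ρ) i = if i = ρ.val then padZero u i + 1 else
      if i = ξ.val then padZero u i - 1 else padZero u i := by
  by_cases hi : i < n
  · simp [padZero, hi, exch, Fin.ext_iff]
  · have := ρ.2
    have := ξ.2
    rw [if_neg (by omega), if_neg (by omega), padZero_of_le _ (by omega),
      padZero_of_le _ (by omega)]

lemma sum_exch {u : Fin n → ℕ} {ξ ρ : Fin n} (hne : ξ ≠ ρ) (hξ : 0 < u ξ) :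
    ∑ j, exch u ξ ρ j = ∑ j, u j := by
  have h : ∑ j, (exch u ξ ρ j + if j = ξ then 1 else 0) =
      ∑ j, (u j + if j = ρ then 1 else 0) := by
    refine Finset.sum_congr rfl fun j _ => ?_
    by_cases h1 : j = ρ
    · subst h1; simp [exch, hne.symm]
    · by_cases h2 : j = ξ
      · subst h2; simp [exch, h1]; omega
      · simp [exch, h1, h2]
  simpa [Finset.sum_add_distrib] using h

set_option maxHeartbeats 1000000 in
theorem SEP_pathG_of_le_six (hn : n ≤ 6) : SEP (pathG n) := by
  intro c _ u hu v hv ξ ρ hξ hρ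
  rw [mem_genW_iff] at hu hv ⊢
  obtain ⟨huc, hup, hus⟩ := hu
  obtain ⟨hvc, hvp, hvs⟩ := hv
  have hne : ξ ≠ ρ := by rintro rfl; omega
  have hb : bdd c (exch u ξ ρ) := by
    intro i
    have h1 := huc i
    have h2 := hvc ρ
    simp only [exch]
    split_ifs with h h'
    · subst h; omega
    all_goals omega
  have hs : ∑ j, exch u ξ ρ j = 2 * deltaC (pathG n) c := by
    rw [sum_exch hne (by omega), hus]
  refine ⟨hb, ?_, hs⟩
  have pad_le : ∀ {a : Fin n → ℕ}, bdd c a → ∀ i, padZero a i ≤ padZero c i := by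
    intro a ha i
    by_cases hi : i < n
    · simpa [padZero, hi] using ha ⟨i, hi⟩
    · rw [padZero_of_le a (by omega)]
      exact Nat.zero_le _
  have hu' := pad_le huc
  have hv' := pad_le hvc
  rw [sum_eq_padZero hn] at hus hvs
  rw [memPow_pathG_iff_of_le_six hn] at hup hvp ⊢
  obtain ⟨p₀, p₁, p₂, p₃, p₄, hp, hp0, hp1, hp2, hp3, hp4, hp5⟩ := hup
  obtain ⟨q₀, q₁, q₂, q₃, q₄, hq, hq0, hq1, hq2, hq3, hq4, hq5⟩ := hvp
  obtain ⟨r₀, r₁, r₂, r₃, r₄, hr, hcov⟩ := exists_matching_eq_cover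
    (padZero c 0) (padZero c 1) (padZero c 2) (padZero c 3) (padZero c 4) (padZero c 5)
  have hδ : r₀ + r₁ + r₂ + r₃ + r₄ ≤ deltaC (pathG n) c :=
    le_deltaC (fun _ => le_rfl)
      ((memPow_pathG_iff_of_le_six hn).2 ⟨r₀, r₁, r₂, r₃, r₄, rfl, hr⟩)
  rw [← padZero_val u, ← padZero_val v] at hξ hρ
  simp only [padZero_exch]
  have hξ6 : ξ.val < 6 := by omega
  have hρ6 : ρ.val < 6 := by omega
  have hne' : ξ.val ≠ ρ.val := fun h => hne (Fin.ext h)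
  generalize deltaC (pathG n) c = d at *
  generalize ξ.val = x at *
  generalize ρ.val = y at *
  have hu0 := hu' 0
  have hu1 := hu' 1
  have hu2 := hu' 2
  have hu3 := hu' 3
  have hu4 := hu' 4
  have hu5 := hu' 5
  have hv0 := hv' 0
  have hv1 := hv' 1
  have hv2 := hv' 2
  have hv3 := hv' 3
  have hv4 := hv' 4
  have hv5 := hv' 5
  clear hu' hv' pad_le hs hb huc hvc hne
  generalize padZero u = U at *
  generalize padZero v = V at *
  generalize padZero c = C at *
  have eu : U 0 = p₀ ∧ U 1 = p₀ + p₁ ∧ U 2 = p₁ + p₂ ∧ U 3 = p₂ + p₃ ∧ U 4 = p₃ + p₄ ∧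
      U 5 = p₄ := by omega
  have ev : V 0 = q₀ ∧ V 1 = q₀ + q₁ ∧ V 2 = q₁ + q₂ ∧ V 3 = q₂ + q₃ ∧ V 4 = q₃ + q₄ ∧
      V 5 = q₄ := by omega
  have tight : (U 1 = V 1 ∧ U 3 = V 3 ∧ U 5 = V 5) ∨
      (U 1 = V 1 ∧ U 3 = V 3 ∧ U 4 = V 4 ∧ p₃ = 0 ∧ q₃ = 0) ∨
      (U 1 = V 1 ∧ U 2 = V 2 ∧ U 4 = V 4 ∧ p₁ = 0 ∧ q₁ = 0) ∨
      (U 0 = V 0 ∧ U 2 = V 2 ∧ U 4 = V 4) ∨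
      (U 0 = V 0 ∧ U 2 = V 2 ∧ U 3 = V 3 ∧ U 5 = V 5 ∧ p₂ = 0 ∧ q₂ = 0) := by
    rcases hcov with h | h | h | h | h
    · exact Or.inl (by omega)
    · exact Or.inr (Or.inl (by omega))
    · exact Or.inr (Or.inr (Or.inl (by omega)))
    · exact Or.inr (Or.inr (Or.inr (Or.inl (by omega))))
    · exact Or.inr (Or.inr (Or.inr (Or.inr (by omega))))
  clear hcov hu0 hu1 hu2 hu3 hu4 hu5 hv0 hv1 hv2 hv3 hv4 hv5 hr hδ hus hvs hq hp0 hp1 hp2 hp3 hp4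
    hp5 hq0 hq1 hq2 hq3 hq4 hq5
  let E : ℕ → ℕ := fun i => if i = y then U i + 1 else if i = x then U i - 1 else U i
  refine ⟨E 0, E 1 - E 0, E 2 - (E 1 - E 0), E 3 - (E 2 - (E 1 - E 0)),
    E 4 - (E 3 - (E 2 - (E 1 - E 0))), ?_⟩
  simp only [E]
  rcases tight with h | h | h | h | h <;> interval_cases x <;> interval_cases y <;> first
    | (exfalso; omega)
    | (norm_num only [if_true, if_false]; omega)

end Path

section LongPath

/-- Capacities on a long path: `2` at the even and `1` at the odd vertices. -/
def altCap (j : ℕ) : ℕ := if j % 2 = 0 then 2 else 1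

/-- Edge multiplicities of a matching using the edges `{0, 1}`, `{3, 4}`, `{4, 5}`,
`{6, 7}`, `{8, 9}`, … . -/
def leftMult (n k : ℕ) : ℕ :=
  if k + 1 < n then if k = 0 ∨ k = 3 ∨ (k % 2 = 0 ∧ 4 ≤ k) then 1 else 0 else 0

/-- Edge multiplicities of a matching using the edges `{1, 2}`, `{2, 3}`, `{5, 6}`,
`{6, 7}`, `{8, 9}`, … . -/
def rightMult (n k : ℕ) : ℕ :=
  if k + 1 < n then if k = 1 ∨ k = 2 ∨ k = 5 ∨ (k % 2 = 0 ∧ 6 ≤ k) then 1 else 0 else 0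

lemma sum_range_ite_succ_lt {n : ℕ} (hn : 1 ≤ n) (f : ℕ → ℕ) :
    ∑ k ∈ range n, (if k + 1 < n then f k else 0) = ∑ k ∈ range (n - 1), f k := by
  obtain ⟨N, rfl⟩ : ∃ N, n = N + 1 := ⟨n - 1, by omega⟩
  rw [Finset.sum_range_succ, if_neg (by omega), add_zero]
  exact Finset.sum_congr rfl fun k hk => if_pos (by simpa using hk)

lemma sum_leftMult {n : ℕ} (hn : 7 ≤ n) : ∑ k ∈ range n, leftMult n k = n / 2 := by
  simp only [leftMult]
  rw [sum_range_ite_succ_lt (by omega)]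
  induction n, hn using Nat.le_induction with
  | base => decide
  | succ n hn ih =>
    obtain ⟨N, rfl⟩ : ∃ N, n = N + 1 := ⟨n - 1, by omega⟩
    simp only [Nat.add_sub_cancel] at *
    rw [Finset.sum_range_succ, ih]
    split_ifs <;> omega

lemma sum_rightMult {n : ℕ} (hn : 7 ≤ n) : ∑ k ∈ range n, rightMult n k = n / 2 := by
  simp only [rightMult]
  rw [sum_range_ite_succ_lt (by omega)]
  induction n, hn using Nat.le_induction with
  | base => decide
  | succ n hn ih =>
    obtain ⟨N, rfl⟩ : ∃ N, n = N + 1 := ⟨n - 1, by omega⟩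
    simp only [Nat.add_sub_cancel] at *
    rw [Finset.sum_range_succ, ih]
    split_ifs <;> omega

lemma sum_odd_indicator (n : ℕ) : ∑ j ∈ range n, (if j % 2 = 1 then 1 else 0) = n / 2 := by
  induction n with
  | zero => rfl
  | succ n ih =>
    rw [Finset.sum_range_succ, ih]
    split_ifs <;> omega

lemma le_half_of_memPow {n q : ℕ} {a : Fin n → ℕ} (hb : bdd (fun j => altCap j) a)
    (h : memPow (pathG n) q a) : q ≤ n / 2 := by
  have h1 := h.mul_le_sum (k := 1) (w := fun j => if j.val % 2 = 1 then 1 else 0) (by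
    intro x y hxy
    rw [pathG_adj] at hxy
    split_ifs <;> omega)
  rw [one_mul] at h1
  refine h1.trans ?_
  rw [← sum_odd_indicator n,
    ← Fin.sum_univ_eq_sum_range (fun j => if j % 2 = 1 then 1 else 0) n]
  refine Finset.sum_le_sum fun j _ => ?_
  have h2 := hb j
  simp only [altCap] at h2
  split_ifs at * <;> omega

lemma bdd_leftMult (n : ℕ) :
    bdd (fun j : Fin n => altCap j) fun j => pathDeg (leftMult n) j := by
  intro j
  simp only [pathDeg, leftMult, altCap]
  split_ifs <;> omega

lemma bdd_rightMult (n : ℕ) :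
    bdd (fun j : Fin n => altCap j) fun j => pathDeg (rightMult n) j := by
  intro j
  simp only [pathDeg, rightMult, altCap]
  split_ifs <;> omega

lemma deltaC_altCap {n : ℕ} (hn : 7 ≤ n) :
    deltaC (pathG n) (fun j => altCap j) = n / 2 := by
  refine IsGreatest.csSup_eq ⟨⟨_, bdd_leftMult n, memPow_pathG_iff.2
    ⟨leftMult n, fun k hk => if_neg (by omega), sum_leftMult hn, fun j => le_rfl⟩⟩, ?_⟩
  rintro q ⟨a, hb, h⟩
  exact le_half_of_memPow hb h

lemma pathDeg_mem_genW {n : ℕ} {c : Fin n → ℕ} {m : ℕ → ℕ} (h0 : ∀ k, n ≤ k + 1 → m k = 0)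
    (hb : bdd c fun j => pathDeg m j) (hs : ∑ k ∈ range n, m k = deltaC (pathG n) c) :
    (fun j : Fin n => pathDeg m j) ∈ genW (pathG n) c :=
  mem_genW_iff.2 ⟨hb, memPow_pathG_iff.2 ⟨m, h0, hs, fun _ => le_rfl⟩, by
    rw [sum_pathDeg h0, hs]⟩

lemma not_memPow_exch_leftMult {n : ℕ} (hn : 7 ≤ n) :
    ¬ memPow (pathG n) (n / 2)
      (exch (fun j : Fin n => pathDeg (leftMult n) j) ⟨0, by omega⟩ ⟨6, by omega⟩) := by
  intro h
  have h1 := h.mul_le_sum (k := 1)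
    (w := fun j => if (j.val % 2 = 1 ∧ j.val ≠ 1) ∨ j.val = 0 ∨ j.val = 2 then 1 else 0) (by
      intro x y hxy
      rw [pathG_adj] at hxy
      split_ifs <;> omega)
  have h2 : ∑ j : Fin n, (if j.val = 1 then 1 else 0) = 1 := by
    rw [Fin.sum_univ_eq_sum_range (fun j => if j = 1 then 1 else 0) n, Finset.sum_ite_eq',
      if_pos (by simp; omega)]
  have h3 := sum_odd_indicator n
  rw [← Fin.sum_univ_eq_sum_range (fun j => if j % 2 = 1 then 1 else 0) n] at h3
  have h4 : ∀ j : Fin n,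
      (if (j.val % 2 = 1 ∧ j.val ≠ 1) ∨ j.val = 0 ∨ j.val = 2 then 1 else 0) *
        exch (fun j : Fin n => pathDeg (leftMult n) j) ⟨0, by omega⟩ ⟨6, by omega⟩ j +
        (if j.val = 1 then 1 else 0) ≤ if j.val % 2 = 1 then 1 else 0 := by
    intro j
    simp only [exch, pathDeg, leftMult, Fin.ext_iff]
    split_ifs <;> omega
  have h5 := Finset.sum_le_sum fun j (_ : j ∈ univ) => h4 j
  rw [Finset.sum_add_distrib] at h5
  omega

theorem not_SEP_pathG {n : ℕ} (hn : 7 ≤ n) : ¬ SEP (pathG n) := by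
  intro h
  have hδ := deltaC_altCap hn
  have hu := pathDeg_mem_genW (m := leftMult n) (fun k hk => if_neg (by omega)) (bdd_leftMult n)
    ((sum_leftMult hn).trans hδ.symm)
  have hv := pathDeg_mem_genW (m := rightMult n) (fun k hk => if_neg (by omega)) (bdd_rightMult n)
    ((sum_rightMult hn).trans hδ.symm)
  have hpos : ∀ j : Fin n, 0 < altCap j := by
    intro j
    simp only [altCap]
    split_ifs <;> omega
  have hex := h _ hpos _ hu _ hv ⟨0, by omega⟩ ⟨6, by omega⟩
    (by simp [pathDeg, leftMult, rightMult]; split_ifs <;> omega)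
    (by simp [pathDeg, leftMult, rightMult]; split_ifs <;> omega)
  have hpow := (mem_genW_iff.1 hex).2.1
  rw [hδ] at hpow
  exact not_memPow_exch_leftMult hn hpow

end LongPath

/-- The path `P_n` (`n ≥ 2`) enjoys the strong exchange property iff
`2 ≤ n ≤ 6`. -/
theorem stmt8 (n : ℕ) (hn : 2 ≤ n) : SEP (pathG n) ↔ n ≤ 6 := by
  refine ⟨fun h => ?_, SEP_pathG_of_le_six⟩
  by_contra hlt
  exact not_SEP_pathG (by omega) h
end

section
/- A tree $G$ enjoys the strong exchange property if and only if either (i) $G$ is the path $P_6$ on six vertices, or (ii) $G$ is obtained from a star graph by attaching at most one pendant edge to each of its leaves. -/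
open Finset

/-- The degree vector of a multiset of edges. -/
def edgeDeg {V : Type*} [DecidableEq V] (M : Multiset (Sym2 V)) (j : V) : ℕ :=
  M.countP (j ∈ ·)

/-- `M` is a multiset of edges of `G` whose degree vector is bounded by `c`. -/
def IsBMatching {V : Type*} [DecidableEq V] (G : SimpleGraph V) (c : V → ℕ)
    (M : Multiset (Sym2 V)) : Prop :=
  (∀ e ∈ M, e ∈ G.edgeSet) ∧ ∀ j, edgeDeg M j ≤ c j

/-- `M` is a `c`-bounded multiset of edges of `G` of maximal cardinality. -/
def IsMaxBMatching {V : Type*} [DecidableEq V] (G : SimpleGraph V) (c : V → ℕ)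
    (M : Multiset (Sym2 V)) : Prop :=
  IsBMatching G c M ∧ ∀ N, IsBMatching G c N → N.card ≤ M.card

/-- Induction on multisets of edges of a graph. -/
lemma edges_induction {V : Type*} {G : SimpleGraph V}
    {P : (M : Multiset (Sym2 V)) → (∀ e ∈ M, e ∈ G.edgeSet) → Prop} (h0 : P 0 (by simp))
    (hc : ∀ a b M (hab : G.Adj a b) (hM : ∀ e ∈ M, e ∈ G.edgeSet), P M hM →
      P (s(a, b) ::ₘ M) (Multiset.forall_mem_cons.2 ⟨hab, hM⟩))
    (M : Multiset (Sym2 V)) (hM : ∀ e ∈ M, e ∈ G.edgeSet) : P M hM := by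
  induction M using Multiset.induction with
  | empty => exact h0
  | cons e M ih =>
    induction e using Sym2.ind with
    | _ a b =>
      have hM' : ∀ e ∈ M, e ∈ G.edgeSet := fun e he => hM e (Multiset.mem_cons_of_mem he)
      exact hc a b M (hM _ (Multiset.mem_cons_self _ _)) hM' (ih hM')

section EdgeDeg

variable {V : Type*} [DecidableEq V]

lemma edgeDeg_zero : edgeDeg (0 : Multiset (Sym2 V)) = 0 := by
  funext j; simp [edgeDeg]

lemma edgeDeg_cons {a b : V} (h : a ≠ b) (M : Multiset (Sym2 V)) :
    edgeDeg (s(a, b) ::ₘ M) = edgeDeg M + Pi.single a 1 + Pi.single b 1 := by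
  funext j
  simp only [edgeDeg, Multiset.countP_cons, Sym2.mem_iff, Pi.add_apply, Pi.single_apply]
  by_cases h1 : j = a
  · subst h1; simp [h]
  · simp [h1]

lemma edgeDeg_add (M N : Multiset (Sym2 V)) : edgeDeg (M + N) = edgeDeg M + edgeDeg N := by
  funext j; simp [edgeDeg]

/-- A multiset of edges is bounded by the degree sum over a vertex cover. -/
lemma card_le_sum_edgeDeg {G : SimpleGraph V} (K : Finset V)
    (hK : ∀ a b, G.Adj a b → a ∈ K ∨ b ∈ K) (M : Multiset (Sym2 V))
    (hM : ∀ e ∈ M, e ∈ G.edgeSet) : M.card ≤ ∑ j ∈ K, edgeDeg M j := by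
  induction M, hM using edges_induction with
  | h0 => simp
  | hc a b M hab _ ih =>
    rw [edgeDeg_cons hab.ne]
    simp only [Pi.add_apply, Finset.sum_add_distrib, Pi.single_apply, Finset.sum_ite_eq',
      Multiset.card_cons]
    rcases hK a b hab with h | h <;> simp only [h, if_true] <;> omega

/-- If each edge has exactly one end in `K`, the degree sum over `K` counts the edges. -/
lemma card_eq_sum_edgeDeg {G : SimpleGraph V} (K : Finset V)
    (hK : ∀ a b, G.Adj a b → (a ∈ K ↔ b ∉ K)) (M : Multiset (Sym2 V))
    (hM : ∀ e ∈ M, e ∈ G.edgeSet) : M.card = ∑ j ∈ K, edgeDeg M j := by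
  induction M, hM using edges_induction with
  | h0 => simp [edgeDeg_zero]
  | hc a b M hab _ ih =>
    rw [edgeDeg_cons hab.ne]
    simp only [Pi.add_apply, Finset.sum_add_distrib, Pi.single_apply, Finset.sum_ite_eq',
      Multiset.card_cons]
    have := hK a b hab
    by_cases h : a ∈ K <;> by_cases h' : b ∈ K <;> simp_all

variable [Fintype V]

lemma sum_edgeDeg {G : SimpleGraph V} (M : Multiset (Sym2 V))
    (hM : ∀ e ∈ M, e ∈ G.edgeSet) : ∑ j, edgeDeg M j = 2 * M.card := by
  induction M, hM using edges_induction with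
  | h0 => simp [edgeDeg_zero]
  | hc a b M hab _ ih =>
    rw [edgeDeg_cons hab.ne]
    simp only [Pi.add_apply, Finset.sum_add_distrib, Pi.single_apply, Finset.sum_ite_eq',
      Multiset.card_cons, ih,
      Finset.mem_univ, if_true]
    ring

lemma sum_mul_edgeDeg_nonneg {G : SimpleGraph V} (φ : V → ℤ) (M : Multiset (Sym2 V))
    (hM : ∀ e ∈ M, e ∈ G.edgeSet) (hφ : ∀ a b, s(a, b) ∈ M → 0 ≤ φ a + φ b) :
    0 ≤ ∑ j, φ j * edgeDeg M j := by
  induction M, hM using edges_induction with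
  | h0 => simp [edgeDeg_zero]
  | hc a b M hab _ ih =>
    have h1 := hφ a b (Multiset.mem_cons_self _ _)
    have h2 := ih fun a b h => hφ a b (Multiset.mem_cons_of_mem h)
    rw [edgeDeg_cons hab.ne]
    simp only [Pi.add_apply, Nat.cast_add, mul_add, Finset.sum_add_distrib, Pi.single_apply,
      Nat.cast_ite, Nat.cast_one, Nat.cast_zero, mul_ite, mul_one, mul_zero, Finset.sum_ite_eq',
      Finset.mem_univ, if_true]
    linarith

lemma edgeDeg_eq_sum_count {G : SimpleGraph V} (M : Multiset (Sym2 V))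
    (hM : ∀ e ∈ M, e ∈ G.edgeSet) (j : V) : edgeDeg M j = ∑ i, M.count s(j, i) := by
  induction M, hM using edges_induction with
  | h0 => simp [edgeDeg_zero]
  | hc a b M hab _ ih =>
    have hne := hab.ne
    rw [edgeDeg_cons hne]
    simp only [Pi.add_apply, Multiset.count_cons, Finset.sum_add_distrib, ← ih, Pi.single_apply,
      add_assoc, Nat.add_left_cancel_iff]
    by_cases h1 : j = a
    · subst h1
      simp [hne]
    · by_cases h2 : j = b
      · subst h2
        simp [h1]
      · simp [h1, h2]

lemma edgeDeg_eq_sum_count_of_nbr {G : SimpleGraph V} (M : Multiset (Sym2 V))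
    (hM : ∀ e ∈ M, e ∈ G.edgeSet) (j : V) (S : Finset V) (hS : ∀ i, G.Adj j i → i ∈ S) :
    edgeDeg M j = ∑ i ∈ S, M.count s(j, i) := by
  rw [edgeDeg_eq_sum_count M hM]
  symm
  refine Finset.sum_subset (Finset.subset_univ _) fun i _ hi => ?_
  rw [Multiset.count_eq_zero]
  exact fun h => hi (hS i (hM _ h))

lemma IsMaxBMatching.not_augment {G : SimpleGraph V} {c : V → ℕ} {M N : Multiset (Sym2 V)}
    (hM : IsMaxBMatching G c M) (hN : ∀ e ∈ N, e ∈ G.edgeSet) {i j : V} (hij : i ≠ j)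
    (h : edgeDeg N = edgeDeg M + Pi.single i 1 + Pi.single j 1)
    (hi : edgeDeg M i < c i) : c j ≤ edgeDeg M j := by
  by_contra! hj
  have h1 := hM.2 N ⟨hN, fun t => by
    have := hM.1.2 t
    rw [h]
    simp only [Pi.add_apply, Pi.single_apply]
    by_cases h1 : t = i
    · subst h1; simp [hij]; omega
    · by_cases h2 : t = j
      · subst h2; simp [h1]; omega
      · simpa [h1, h2]⟩
  have h2 := sum_edgeDeg M hM.1.1
  have h3 := sum_edgeDeg N hN
  rw [h] at h3
  simp only [Pi.add_apply, Finset.sum_add_distrib, Pi.single_apply, Finset.sum_ite_eq', h2,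
      Finset.mem_univ, if_true] at h3
  omega

lemma IsMaxBMatching.le_of_adj {G : SimpleGraph V} {c : V → ℕ} {M : Multiset (Sym2 V)}
    (hM : IsMaxBMatching G c M) {i j : V} (hij : G.Adj i j) (hi : edgeDeg M i < c i) :
    c j ≤ edgeDeg M j :=
  hM.not_augment (N := s(i, j) ::ₘ M) (Multiset.forall_mem_cons.2 ⟨hij, hM.1.1⟩) hij.ne
    (edgeDeg_cons hij.ne M) hi

lemma IsMaxBMatching.le_of_adj₃ {G : SimpleGraph V} {c : V → ℕ} {M : Multiset (Sym2 V)}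
    (hM : IsMaxBMatching G c M) {i k l j : V} (hik : G.Adj i k) (hkl : s(k, l) ∈ M)
    (hlj : G.Adj l j) (hij : i ≠ j) (hi : edgeDeg M i < c i) : c j ≤ edgeDeg M j := by
  obtain ⟨M, rfl⟩ := Multiset.exists_cons_of_mem hkl
  have hE := Multiset.forall_mem_cons.1 hM.1.1
  have hne : k ≠ l := G.ne_of_adj hE.1
  refine hM.not_augment (N := s(i, k) ::ₘ s(l, j) ::ₘ M) ?_ hij ?_ hi
  · exact Multiset.forall_mem_cons.2 ⟨hik, Multiset.forall_mem_cons.2 ⟨hlj, hE.2⟩⟩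
  · rw [edgeDeg_cons hik.ne, edgeDeg_cons hlj.ne, edgeDeg_cons hne]
    abel

end EdgeDeg

lemma memPow_iff {n : ℕ} (G : SimpleGraph (Fin n)) (q : ℕ) (a : Fin n → ℕ) :
    memPow G q a ↔
      ∃ M : Multiset (Sym2 (Fin n)), M.card = q ∧ (∀ e ∈ M, e ∈ G.edgeSet) ∧
        ∀ j, edgeDeg M j ≤ a j := by
  have key : ∀ (q : ℕ) (e : Fin q → Fin n × Fin n), (∀ i, G.Adj (e i).1 (e i).2) →
      ∀ j, edgeDeg ((univ : Finset (Fin q)).val.map fun i => s((e i).1, (e i).2)) j =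
        ∑ i, ((if (e i).1 = j then 1 else 0) + (if (e i).2 = j then 1 else 0)) := by
    intro q e he j
    rw [edgeDeg, Multiset.countP_map, ← Finset.filter_val, Finset.card_val, Finset.card_filter]
    refine Finset.sum_congr rfl fun i _ => ?_
    have := (he i).ne
    by_cases h1 : (e i).1 = j
    · subst h1; simp [this.symm]
    · simp [h1, Ne.symm h1, eq_comm]
  constructor
  · rintro ⟨e, he, ha⟩
    refine ⟨univ.val.map fun i => s((e i).1, (e i).2), by simp, ?_, fun j => ?_⟩
    · intro x hx
      obtain ⟨i, -, rfl⟩ := Multiset.mem_map.1 hx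
      exact he i
    · rw [key q e he]; exact ha j
  · rintro ⟨M, rfl, hM, ha⟩
    obtain ⟨l, rfl⟩ : ∃ l : List (Sym2 (Fin n)), (l : Multiset (Sym2 (Fin n))) = M :=
      ⟨M.toList, M.coe_toList⟩
    have hl : ∀ i : Fin l.length, G.Adj (l.get i).out.1 (l.get i).out.2 := fun i => by
      have := hM (l.get i) (List.get_mem l i)
      rw [← (l.get i).out_eq] at this
      exact this
    refine ⟨fun i => (l.get i).out, hl, fun j => ?_⟩
    refine le_of_eq_of_le ?_ (ha j)
    refine (key l.length (fun i => (l.get i).out) hl j).symm.trans ?_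
    congr 1
    have : (fun i : Fin l.length => s((l.get i).out.1, (l.get i).out.2)) = l.get := by
      funext i; exact (l.get i).out_eq
    rw [this]
    simp [Fin.univ_val_map]

lemma le_deltaC_s14 {n : ℕ} {G : SimpleGraph (Fin n)} {c : Fin n → ℕ} {M : Multiset (Sym2 (Fin n))}
    (hM : IsBMatching G c M) : M.card ≤ deltaC G c := by
  refine le_csSup ⟨∑ i, c i, ?_⟩ ⟨c, fun i => le_rfl, (memPow_iff G _ c).2 ⟨M, rfl, hM⟩⟩
  rintro q ⟨a, ha, hq⟩
  obtain ⟨N, rfl, hN, hNa⟩ := (memPow_iff G q a).1 hq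
  have h1 := sum_edgeDeg N hN
  have h2 : ∑ j, edgeDeg N j ≤ ∑ i, c i :=
    Finset.sum_le_sum fun j _ => (hNa j).trans (ha j)
  omega

lemma exists_card_eq_deltaC {n : ℕ} (G : SimpleGraph (Fin n)) (c : Fin n → ℕ) :
    ∃ M, IsBMatching G c M ∧ M.card = deltaC G c := by
  have : deltaC G c ∈ {q | ∃ a, bdd c a ∧ memPow G q a} := by
    refine Nat.sSup_mem ⟨0, c, fun i => le_rfl, (memPow_iff G _ c).2 ⟨0, rfl, by simp, by
      simp [edgeDeg_zero]⟩⟩ ⟨∑ i, c i, ?_⟩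
    rintro q ⟨a, ha, hq⟩
    obtain ⟨N, rfl, hN, hNa⟩ := (memPow_iff G q a).1 hq
    have h1 := sum_edgeDeg N hN
    have h2 : ∑ j, edgeDeg N j ≤ ∑ i, c i :=
      Finset.sum_le_sum fun j _ => (hNa j).trans (ha j)
    omega
  obtain ⟨a, ha, hq⟩ := this
  obtain ⟨N, hc, hN, hNa⟩ := (memPow_iff G _ a).1 hq
  exact ⟨N, ⟨hN, fun j => (hNa j).trans (ha j)⟩, hc⟩

/-- The minimal generators are the degree vectors of the maximum `c`-bounded multisets of edges. -/
lemma mem_genW_iff_s14 {n : ℕ} (G : SimpleGraph (Fin n)) (c a : Fin n → ℕ) :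
    a ∈ genW G c ↔ ∃ M, IsMaxBMatching G c M ∧ edgeDeg M = a := by
  constructor
  · rintro ⟨ha, hq, hmin⟩
    obtain ⟨M, hc, hM, hMa⟩ := (memPow_iff G _ a).1 hq
    refine ⟨M, ⟨⟨hM, fun j => (hMa j).trans (ha j)⟩, fun N hN => hc ▸ le_deltaC_s14 hN⟩, ?_⟩
    exact hmin _ hMa ((memPow_iff G _ _).2 ⟨M, hc, hM, fun j => le_rfl⟩)
  · rintro ⟨M, hM, rfl⟩
    obtain ⟨N, hN, hNc⟩ := exists_card_eq_deltaC G c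
    have hc : M.card = deltaC G c := le_antisymm (le_deltaC_s14 hM.1) (hNc ▸ hM.2 N hN)
    refine ⟨hM.1.2, (memPow_iff G _ _).2 ⟨M, hc, hM.1.1, fun j => le_rfl⟩, fun b hb hq => ?_⟩
    obtain ⟨L, hLc, hL, hLb⟩ := (memPow_iff G _ _).1 hq
    have h1 := sum_edgeDeg M hM.1.1
    have h2 := sum_edgeDeg L hL
    have h3 : ∑ j, edgeDeg L j ≤ ∑ j, b j := Finset.sum_le_sum fun j _ => hLb j
    have h4 : ∑ j, b j ≤ ∑ j, edgeDeg M j := Finset.sum_le_sum fun j _ => hb j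
    funext j
    exact (Finset.sum_eq_sum_iff_of_le fun j _ => hb j).1 (by omega) j (Finset.mem_univ j)

lemma exch_mem_genW {n : ℕ} {G : SimpleGraph (Fin n)} {c : Fin n → ℕ}
    {M N : Multiset (Sym2 (Fin n))} (hM : IsMaxBMatching G c M) (hN : ∀ e ∈ N, e ∈ G.edgeSet)
    {ξ ρ : Fin n} (hne : ξ ≠ ρ)
    (h : edgeDeg N + Pi.single ξ 1 = edgeDeg M + Pi.single ρ 1)
    (hρ : edgeDeg M ρ < c ρ) : exch (edgeDeg M) ξ ρ ∈ genW G c := by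
  have hval : ∀ j, edgeDeg N j = exch (edgeDeg M) ξ ρ j := fun j => by
    have := congrFun h j
    simp only [Pi.add_apply, Pi.single_apply] at this
    unfold exch
    by_cases h1 : j = ρ
    · subst h1; simp_all [hne.symm]
    · by_cases h2 : j = ξ
      · subst h2; simp_all; omega
      · simp_all
  have hcard : N.card = M.card := by
    have h1 := sum_edgeDeg M hM.1.1
    have h2 := sum_edgeDeg N hN
    have h3 := congrArg (fun f : Fin n → ℕ => ∑ j, f j) h
    simp only [Pi.add_apply, Finset.sum_add_distrib, Pi.single_apply, Finset.sum_ite_eq',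
      Finset.mem_univ, if_true] at h3
    omega
  refine (mem_genW_iff_s14 G c _).2 ⟨N, ⟨⟨hN, fun j => ?_⟩, fun L hL => hcard ▸ hM.2 L hL⟩,
    funext hval⟩
  rw [hval, exch]
  have := hM.1.2 j
  split_ifs with h1
  · subst h1; omega
  · omega
  · omega

lemma exch_mem_genW_of_adj₂ {n : ℕ} {G : SimpleGraph (Fin n)} {c : Fin n → ℕ}
    {M : Multiset (Sym2 (Fin n))} (hM : IsMaxBMatching G c M) {ρ k ξ : Fin n}
    (h1 : G.Adj ρ k) (h2 : s(k, ξ) ∈ M) (hne : ξ ≠ ρ) (hρ : edgeDeg M ρ < c ρ) :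
    exch (edgeDeg M) ξ ρ ∈ genW G c := by
  obtain ⟨L, hL⟩ := Multiset.exists_cons_of_mem h2
  have hE := Multiset.forall_mem_cons.1 (hL ▸ hM.1.1)
  refine exch_mem_genW hM (N := s(ρ, k) ::ₘ L) (Multiset.forall_mem_cons.2 ⟨h1, hE.2⟩) hne ?_ hρ
  rw [hL, edgeDeg_cons h1.ne, edgeDeg_cons (G.ne_of_adj hE.1)]
  abel

lemma exch_mem_genW_of_adj₄ {n : ℕ} {G : SimpleGraph (Fin n)} {c : Fin n → ℕ}
    {M : Multiset (Sym2 (Fin n))} (hM : IsMaxBMatching G c M) {ρ k l k' ξ : Fin n}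
    (h1 : G.Adj ρ k) (h2 : s(k, l) ∈ M) (h3 : G.Adj l k') (h4 : s(k', ξ) ∈ M)
    (h24 : s(k', ξ) ≠ s(k, l)) (hne : ξ ≠ ρ) (hρ : edgeDeg M ρ < c ρ) :
    exch (edgeDeg M) ξ ρ ∈ genW G c := by
  obtain ⟨L, hL⟩ := Multiset.exists_cons_of_mem h2
  have h4' : s(k', ξ) ∈ L := by
    rw [hL, Multiset.mem_cons] at h4
    exact h4.resolve_left h24
  obtain ⟨L, rfl⟩ := Multiset.exists_cons_of_mem h4'
  have hE := Multiset.forall_mem_cons.1 (hL ▸ hM.1.1)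
  have hE' := Multiset.forall_mem_cons.1 hE.2
  refine exch_mem_genW hM (N := s(ρ, k) ::ₘ s(l, k') ::ₘ L) (Multiset.forall_mem_cons.2
    ⟨h1, Multiset.forall_mem_cons.2 ⟨h3, hE'.2⟩⟩) hne ?_ hρ
  rw [hL, edgeDeg_cons h1.ne, edgeDeg_cons h3.ne, edgeDeg_cons (G.ne_of_adj hE.1),
    edgeDeg_cons (G.ne_of_adj hE'.1)]
  abel

/-- The multiset joining each vertex `k` of `K` to `g k`. -/
def chosenEdges {V : Type*} (K : Finset V) (g : V → V) : Multiset (Sym2 V) :=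
  K.val.map fun k => s(k, g k)

section ChosenEdges

variable {V : Type*} [DecidableEq V]

lemma edgeDeg_chosenEdges (K : Finset V) (g : V → V) (j : V) :
    edgeDeg (chosenEdges K g) j = #{k ∈ K | j = k ∨ j = g k} := by
  rw [edgeDeg, chosenEdges, Multiset.countP_map, ← Finset.filter_val, Finset.card_val]
  simp

lemma edgeDeg_chosenEdges_lt {K : Finset V} {g h : V → V} {j : V} (hj : j ∉ K)
    (hgh : ∀ k ∈ K, g k = j → h k = j) {k₀ : V} (hk₀ : k₀ ∈ K) (hh : h k₀ = j) (hg : g k₀ ≠ j) :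
    edgeDeg (chosenEdges K g) j < edgeDeg (chosenEdges K h) j := by
  rw [edgeDeg_chosenEdges, edgeDeg_chosenEdges]
  refine Finset.card_lt_card (Finset.ssubset_iff_of_subset ?_ |>.2 ⟨k₀, ?_, ?_⟩)
  · intro k hk
    rw [Finset.mem_filter] at hk ⊢
    refine ⟨hk.1, Or.inr ?_⟩
    rcases hk.2 with rfl | h1
    · exact absurd hk.1 hj
    · exact (hgh k hk.1 h1.symm).symm
  · simp [hk₀, hh]
  · simp only [Finset.mem_filter, hk₀, true_and, not_or]
    exact ⟨fun h1 => hj (h1 ▸ hk₀), hg.symm⟩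

lemma isMaxBMatching_chosenEdges {G : SimpleGraph V} {K : Finset V}
    (hK : ∀ a b, G.Adj a b → a ∈ K ∨ b ∈ K) {g : V → V} (hg : ∀ k ∈ K, G.Adj k (g k) ∧ g k ∉ K) :
    IsMaxBMatching G (fun k => if k ∈ K then 1 else K.card + 1) (chosenEdges K g) := by
  have hcard : (chosenEdges K g).card = K.card := by simp [chosenEdges]
  refine ⟨⟨?_, fun j => ?_⟩, fun N hN => ?_⟩
  · intro e he
    obtain ⟨k, hk, rfl⟩ := Multiset.mem_map.1 he
    exact (hg k hk).1
  · rw [edgeDeg_chosenEdges]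
    by_cases hj : j ∈ K <;> simp only [hj, if_true, if_false]
    · refine (Finset.card_le_card (t := {j}) fun k hk => ?_).trans_eq (Finset.card_singleton j)
      rw [Finset.mem_filter] at hk
      rcases hk.2 with rfl | h
      · exact Finset.mem_singleton_self _
      · exact absurd (h ▸ hj) (hg k hk.1).2
    · exact (Finset.card_filter_le _ _).trans (Nat.le_succ _)
  · rw [hcard]
    refine (card_le_sum_edgeDeg K hK N hN.1).trans ?_
    refine (Finset.sum_le_card_nsmul K _ 1 fun j hj => ?_).trans_eq (by simp)
    simpa [hj] using hN.2 j

end ChosenEdges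

/-- If the maximum multisets of edges given by `g` and `h` differ at `ρ` and `ξ` and the exchange
at these vertices violates a linear inequality valid on all degree vectors, then the strong
exchange property fails. -/
lemma not_SEP_of_chosenEdges {n : ℕ} {G : SimpleGraph (Fin n)} {K : Finset (Fin n)}
    (hK : ∀ a b, G.Adj a b → a ∈ K ∨ b ∈ K) {g h : Fin n → Fin n}
    (hg : ∀ k ∈ K, G.Adj k (g k) ∧ g k ∉ K) (hh : ∀ k ∈ K, G.Adj k (h k) ∧ h k ∉ K)
    {ρ ξ : Fin n}
    (hρ : ∀ k ∈ K, g k = ρ → h k = ρ) (hρ' : ∃ k ∈ K, h k = ρ ∧ g k ≠ ρ)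
    (hξ : ∀ k ∈ K, h k = ξ → g k = ξ) (hξ' : ∃ k ∈ K, g k = ξ ∧ h k ≠ ξ)
    (φ : Fin n → ℤ) (hφ : ∀ a b, G.Adj a b → 0 ≤ φ a + φ b)
    (hφg : ∀ k ∈ K, φ k + φ (g k) = 0) (hlt : φ ρ < φ ξ) : ¬ SEP G := by
  intro hS
  obtain ⟨k₁, hk₁, h1, h1'⟩ := hρ'
  obtain ⟨k₂, hk₂, h2, h2'⟩ := hξ'
  have hMg := isMaxBMatching_chosenEdges hK hg
  have hMh := isMaxBMatching_chosenEdges hK hh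
  have hξlt := edgeDeg_chosenEdges_lt (h2 ▸ (hg k₂ hk₂).2) hξ hk₂ h2 h2'
  have hρlt := edgeDeg_chosenEdges_lt (h1 ▸ (hh k₁ hk₁).2) hρ hk₁ h1 h1'
  have := hS (fun k => if k ∈ K then 1 else K.card + 1) (fun i => by split_ifs <;> omega)
    _ ((mem_genW_iff_s14 G _ _).2 ⟨_, hMg, rfl⟩) _ ((mem_genW_iff_s14 G _ _).2 ⟨_, hMh, rfl⟩) ξ ρ hξlt hρlt
  obtain ⟨N, hN, hNe⟩ := (mem_genW_iff_s14 G _ _).1 this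
  have e1 := sum_mul_edgeDeg_nonneg φ N hN.1.1 fun a b hab => hφ a b (hN.1.1 _ hab)
  have e2 := sum_mul_edgeDeg_nonneg (fun j => -φ j) _ hMg.1.1 (by
    intro a b hab
    obtain ⟨k, hk, he⟩ := Multiset.mem_map.1 hab
    have := hφg k hk
    rw [Sym2.eq_iff] at he
    rcases he with ⟨rfl, rfl⟩ | ⟨rfl, rfl⟩ <;> linarith)
  have hne : ξ ≠ ρ := fun h => hlt.ne (h ▸ rfl)
  have e3 : ∀ j, φ j * (edgeDeg N j : ℤ) = φ j * edgeDeg (chosenEdges K g) j +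
      (if j = ρ then φ j else 0) - (if j = ξ then φ j else 0) := by
    intro j
    rw [hNe, exch]
    by_cases h3 : j = ρ
    · subst h3; simp [hne.symm]; ring
    · by_cases h4 : j = ξ
      · subst h4
        have : 1 ≤ edgeDeg (chosenEdges K g) j := by omega
        simp only [h3, if_true, if_false]
        push_cast [this]
        ring
      · simp [h3, h4]
  simp only [e3, Finset.sum_add_distrib, Finset.sum_sub_distrib, Finset.sum_ite_eq',
    Finset.mem_univ, if_true] at e1
  simp only [neg_mul, Finset.sum_neg_distrib] at e2
  linarith

namespace SimpleGraph.IsTree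

variable {V : Type*} [Fintype V] {G : SimpleGraph V}

lemma exists_bipartition (hG : G.IsTree) (u : V) :
    ∃ K : Finset V, u ∈ K ∧ ∀ a b, G.Adj a b → (a ∈ K ↔ b ∉ K) := by
  classical
  refine ⟨Finset.univ.filter fun z => G.dist u z % 2 = 0, by simp, fun a b hab => ?_⟩
  have := hG.dist_eq_dist_add_one_of_adj u hab
  simp only [Finset.mem_filter, Finset.mem_univ, true_and]
  omega

lemma exists_cut (hG : G.IsTree) {u v : V} (huv : G.Adj u v) :
    ∃ C : Finset V, u ∈ C ∧ v ∉ C ∧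
      ∀ a b, G.Adj a b → s(a, b) ≠ s(u, v) → (a ∈ C ↔ b ∈ C) := by
  classical
  refine ⟨Finset.univ.filter fun z => (G.deleteEdges {s(u, v)}).Reachable u z, by simp, ?_,
    fun a b hab hne => ?_⟩
  · simpa using isBridge_iff.1 (isAcyclic_iff_forall_adj_isBridge.1 hG.isAcyclic huv)
  · have h : (G.deleteEdges {s(u, v)}).Adj a b := by simp [hab, hne]
    simp only [Finset.mem_filter, Finset.mem_univ, true_and]
    exact ⟨fun h1 => h1.trans h.reachable, fun h1 => h1.trans h.symm.reachable⟩

end SimpleGraph.IsTree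

section Obstructions

variable {n : ℕ} {G : SimpleGraph (Fin n)}

lemma not_SEP_of_cut {K C : Finset (Fin n)}
    (hK : ∀ a b, G.Adj a b → (a ∈ K ↔ b ∉ K)) {f : Fin n → Fin n} (hf : ∀ k, G.Adj k (f k))
    {u v u' w s r₀ r₁ r₂ : Fin n} (huK : u ∈ K) (hsK : s ∈ K) (huC : u ∈ C) (hvC : v ∉ C)
    (hC : ∀ a b, G.Adj a b → s(a, b) ≠ s(u, v) → (a ∈ C ↔ b ∈ C))
    (huv : G.Adj u v) (hvu' : G.Adj v u') (hu' : u' ≠ u) (hu'w : G.Adj u' w) (hw : w ≠ v)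
    (hr₀ : G.Adj u r₀) (hr₀v : r₀ ≠ v) (hr₁ : G.Adj s r₁) (hr₂ : G.Adj s r₂) (hr : r₁ ≠ r₂)
    (hr₁C : r₁ ∈ C) (hr₂C : r₂ ∈ C) (hsC : s ∈ C) : ¬ SEP G := by
  have hvK : v ∉ K := (hK _ _ huv).1 huK
  have hu'K : u' ∈ K := (hK _ _ hvu'.symm).2 hvK
  have hu'C : u' ∉ C := fun h => hvC ((hC v u' hvu' (by
    rw [Ne, Sym2.eq_iff]; rintro (⟨rfl, -⟩ | ⟨-, h⟩); exacts [huv.ne rfl, hu' h])).2 h)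
  have hwK : w ∉ K := (hK _ _ hu'w).1 hu'K
  have hwC : w ∉ C := fun h => hu'C ((hC u' w hu'w (by
    rw [Ne, Sym2.eq_iff]; rintro (⟨h, -⟩ | ⟨-, rfl⟩); exacts [hu' h, hwK huK])).2 h)
  have hsu' : s ≠ u' := fun h => hu'C (h ▸ hsC)
  let g₀ : Fin n → Fin n := fun k => if k = u then r₀ else f k
  let g : Fin n → Fin n := fun k => if k = s then r₁ else if k = u' then w else g₀ k
  let h : Fin n → Fin n := fun k => if k = s then r₂ else if k = u' then v else g₀ k
  have hg₀ : ∀ k, G.Adj k (g₀ k) := fun k => by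
    simp only [g₀]; split_ifs with h1
    · subst h1; exact hr₀
    · exact hf k
  have hg : ∀ k, G.Adj k (g k) := fun k => by
    simp only [g]; split_ifs with h1 h2
    · subst h1; exact hr₁
    · subst h2; exact hu'w
    · exact hg₀ k
  have hh : ∀ k, G.Adj k (h k) := fun k => by
    simp only [h]; split_ifs with h1 h2
    · subst h1; exact hr₂
    · subst h2; exact hvu'.symm
    · exact hg₀ k
  have hne : ∀ a b : Fin n, a ∈ C → b ∉ C → a ≠ b := fun a b ha hb hab => hb (hab ▸ ha)
  have hgu : g u ≠ v := by
    simp only [g, g₀, hu'.symm, if_false, if_true]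
    split_ifs
    · exact hne _ _ hr₁C hvC
    · exact hr₀v
  refine not_SEP_of_chosenEdges (K := K) (g := g) (h := h) (ρ := r₂) (ξ := w)
    (fun a b hab => by have := hK a b hab; tauto)
    (fun k hk => ⟨hg k, (hK _ _ (hg k)).1 hk⟩) (fun k hk => ⟨hh k, (hK _ _ (hh k)).1 hk⟩)
    ?_ ⟨s, hsK, by simp [h], by simpa [g] using hr⟩ ?_
    ⟨u', hu'K, by simp [g, hsu'.symm], by simpa [h, hsu'.symm] using hw.symm⟩
    (fun z => if z ∈ C then (if z ∈ K then 1 else -1) else 0) ?_ ?_ ?_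
  · intro k _ hk
    simp only [g, h] at hk ⊢
    split_ifs at hk ⊢ with h1 h2
    · rfl
    · exact absurd hk.symm (hne _ _ hr₂C hwC)
    · exact hk
  · intro k _ hk
    simp only [g, h] at hk ⊢
    split_ifs at hk ⊢ with h1 h2
    · exact absurd hk (hne _ _ hr₂C hwC)
    · rfl
    · exact hk
  · intro a b hab
    have h1 := hK a b hab
    by_cases h2 : s(a, b) = s(u, v)
    · rw [Sym2.eq_iff] at h2
      rcases h2 with ⟨rfl, rfl⟩ | ⟨rfl, rfl⟩ <;> simp [huC, hvC, huK]
    · have h3 := hC a b hab h2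
      by_cases ha : a ∈ C <;> by_cases hb : a ∈ K <;> simp_all
  · intro k hk
    have h1 := (hK _ _ (hg k)).1 hk
    have h3 := hC k (g k) (hg k) (by
      rw [Ne, Sym2.eq_iff]; rintro (⟨rfl, h4⟩ | ⟨rfl, -⟩); exacts [hgu h4, hvK hk])
    by_cases ha : k ∈ C <;> simp_all
  · have : r₂ ∉ K := (hK _ _ hr₂).1 hsK
    simp [hr₂C, hwC, this]

lemma exists_forall_adj (hG : G.IsTree) {u v : Fin n} (huv : G.Adj u v) :
    ∃ f : Fin n → Fin n, ∀ k, G.Adj k (f k) := by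
  have : Nontrivial (Fin n) := ⟨u, v, huv.ne⟩
  exact ⟨_, fun k => (hG.connected.preconnected.exists_adj_of_nontrivial k).choose_spec⟩

lemma not_SEP_of_degree_three (hG : G.IsTree) {u w₁ w₂ v u' w : Fin n} (h1 : G.Adj u w₁)
    (h2 : G.Adj u w₂) (h12 : w₁ ≠ w₂) (h1v : w₁ ≠ v) (h2v : w₂ ≠ v) (huv : G.Adj u v)
    (hvu' : G.Adj v u') (hu' : u' ≠ u) (hu'w : G.Adj u' w) (hw : w ≠ v) : ¬ SEP G := by
  obtain ⟨f, hf⟩ := exists_forall_adj hG huv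
  obtain ⟨K, huK, hK⟩ := hG.exists_bipartition u
  obtain ⟨C, huC, hvC, hC⟩ := hG.exists_cut huv
  refine not_SEP_of_cut hK hf huK huK huC hvC hC huv hvu' hu' hu'w hw h1 h1v h1 h2 h12 ?_ ?_ huC
  · exact (hC _ _ h1 (by simp [h1v, huv.ne])).1 huC
  · exact (hC _ _ h2 (by simp [h2v, huv.ne])).1 huC

lemma not_SEP_of_path_seven (hG : G.IsTree) {p : Fin 7 → Fin n}
    (hp : ∀ i : Fin 6, G.Adj (p i.castSucc) (p i.succ))
    (hp' : ∀ i : Fin 5, p i.castSucc.castSucc ≠ p i.succ.succ) : ¬ SEP G := by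
  have h01 : G.Adj (p 0) (p 1) := hp 0
  have h12 : G.Adj (p 1) (p 2) := hp 1
  have h23 : G.Adj (p 2) (p 3) := hp 2
  have h34 : G.Adj (p 3) (p 4) := hp 3
  have h45 : G.Adj (p 4) (p 5) := hp 4
  have h56 : G.Adj (p 5) (p 6) := hp 5
  have h02 : p 0 ≠ p 2 := hp' 0
  have h13 : p 1 ≠ p 3 := hp' 1
  have h24 : p 2 ≠ p 4 := hp' 2
  have h35 : p 3 ≠ p 5 := hp' 3
  have h46 : p 4 ≠ p 6 := hp' 4
  obtain ⟨f, hf⟩ := exists_forall_adj hG h01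
  obtain ⟨K, h3K, hK⟩ := hG.exists_bipartition (p 3)
  obtain ⟨C, h3C, h4C, hC⟩ := hG.exists_cut h34
  have h2K := hK _ _ h23
  have h1K := hK _ _ h12
  have h0K := hK _ _ h01
  have h4K := hK _ _ h34
  have h2C : p 2 ∈ C := (hC _ _ h23.symm (by simp [h24, h34.ne])).1 h3C
  have h1C : p 1 ∈ C := (hC _ _ h12.symm (by
    rw [Ne, Sym2.eq_iff]; rintro (⟨h, -⟩ | ⟨h, -⟩); exacts [h23.ne h, h24 h])).1 h2C
  have h0C : p 0 ∈ C := (hC _ _ h01.symm (by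
    rw [Ne, Sym2.eq_iff]
    rintro (⟨h, -⟩ | ⟨h, -⟩)
    · exact h13 h
    · exact h4C (h ▸ h1C))).1 h1C
  exact not_SEP_of_cut hK hf h3K (by tauto) h3C h4C hC h34 h45 h35.symm h56 h46.symm h23.symm h24
    h01.symm h12 h02 h0C h2C h1C

lemma not_SEP_of_adj_degree_three (hG : G.IsTree) {u v a b c d : Fin n} (huv : G.Adj u v)
    (ha : G.Adj u a) (hb : G.Adj u b) (hab : a ≠ b) (hav : a ≠ v) (hbv : b ≠ v)
    (hc : G.Adj v c) (hd : G.Adj v d) (hcd : c ≠ d) (hcu : c ≠ u) (hdu : d ≠ u) : ¬ SEP G := by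
  obtain ⟨f, hf⟩ := exists_forall_adj hG huv
  obtain ⟨A, huA, hA⟩ := hG.exists_bipartition u
  obtain ⟨C, huC, hvC, hC⟩ := hG.exists_cut huv
  have hvA : v ∉ A := (hA _ _ huv).1 huA
  have haA : a ∉ A := (hA _ _ ha).1 huA
  have hbA : b ∉ A := (hA _ _ hb).1 huA
  have hcA : c ∈ A := by have := hA _ _ hc; tauto
  have hdA : d ∈ A := by have := hA _ _ hd; tauto
  have haC : a ∈ C := (hC _ _ ha (by simp [hav, huv.ne])).1 huC
  have hbC : b ∈ C := (hC _ _ hb (by simp [hbv, huv.ne])).1 huC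
  have hcC : c ∉ C := fun h => hvC ((hC _ _ hc (by simp [hcu, huv.ne'])).2 h)
  have hdC : d ∉ C := fun h => hvC ((hC _ _ hd (by simp [hdu, huv.ne'])).2 h)
  let K : Finset (Fin n) := {k | k ∈ C ↔ k ∈ A}
  have hKmem : ∀ k, k ∈ K ↔ (k ∈ C ↔ k ∈ A) := fun k => by simp [K]
  have hKC : ∀ k l, G.Adj k l → k ∈ K → s(k, l) ≠ s(u, v) → l ∉ K := fun k l hkl hk hne => by
    have h1 := hC k l hkl hne
    have h2 := hA k l hkl
    rw [hKmem] at hk ⊢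
    tauto
  have hne : ∀ a b : Fin n, a ∈ C → b ∉ C → a ≠ b := fun a b ha hb hab => hb (hab ▸ ha)
  have key : ∀ x y, G.Adj u x → x ≠ v → G.Adj v y → y ≠ u → ∀ k ∈ K,
      G.Adj k (if k = u then x else if k = v then y else f k) ∧
        (if k = u then x else if k = v then y else f k) ∉ K := by
    intro x y hx hxv hy hyu k hk
    split_ifs with h1 h2
    · subst h1; exact ⟨hx, hKC _ _ hx hk (by simp [hxv, huv.ne])⟩
    · subst h2; exact ⟨hy, hKC _ _ hy hk (by simp [hyu, huv.ne'])⟩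
    · exact ⟨hf k, hKC _ _ (hf k) hk (by simp [h1, h2])⟩
  refine not_SEP_of_chosenEdges (K := K)
    (g := fun k => if k = u then a else if k = v then c else f k)
    (h := fun k => if k = u then b else if k = v then d else f k) (ρ := d) (ξ := a)
    ?_ (key a c ha hav hc hcu) (key b d hb hbv hd hdu)
    ?_ ⟨v, by simp [hKmem, hvC, hvA], by simp [huv.ne'], by simpa [huv.ne'] using hcd⟩
    ?_ ⟨u, by simp [hKmem, huC, huA], by simp, by simpa using hab.symm⟩
    (fun z => if z ∈ A then -1 else 1) ?_ ?_ ?_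
  · intro k l hkl
    by_cases h : s(k, l) = s(u, v)
    · rw [Sym2.eq_iff] at h
      rcases h with ⟨rfl, rfl⟩ | ⟨rfl, rfl⟩ <;> simp [hKmem, huC, huA, hvC, hvA]
    · have h1 := hC k l hkl h
      have h2 := hA k l hkl
      rw [hKmem, hKmem]
      tauto
  · intro k _ hk
    split_ifs at hk ⊢ with h1 h2
    · exact absurd hk (hne _ _ haC hdC)
    · rfl
    · exact hk
  · intro k _ hk
    split_ifs at hk ⊢ with h1 h2
    · rfl
    · exact absurd hk.symm (hne _ _ haC hdC)
    · exact hk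
  · intro k l hkl
    have := hA k l hkl
    by_cases h : k ∈ A <;> simp_all
  · intro k hk
    have := hA _ _ (key a c ha hav hc hcu k hk).1
    by_cases h : k ∈ A <;> simp_all
  · simp [hdA, haA]

end Obstructions

lemma count_le_edgeDeg {V : Type*} [DecidableEq V] (M : Multiset (Sym2 V)) (a b : V) :
    M.count s(a, b) ≤ edgeDeg M a := by
  induction M using Multiset.induction_on with
  | empty => simp
  | cons e M ih =>
    rw [Multiset.count_cons, edgeDeg, Multiset.countP_cons, ← edgeDeg]
    split_ifs with h h' <;> [omega; (subst h; simp at h'); omega; omega]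

/-- A tree in which every vertex is within distance two of `v`, and every neighbor of `v` has at
most one further neighbor. -/
structure IsExtendedStar {V : Type*} (G : SimpleGraph V) (v : V) : Prop where
  cover : ∀ z, z = v ∨ G.Adj v z ∨ ∃ u, G.Adj v u ∧ G.Adj u z
  unique : ∀ u x y, G.Adj v u → G.Adj u x → G.Adj u y → x ≠ v → y ≠ v → x = y

namespace IsExtendedStar

variable {V : Type*} {G : SimpleGraph V} {v : V}

lemma edgeDeg_parent_eq [Finite V] [DecidableEq V] {M : Multiset (Sym2 V)}
    (h : IsExtendedStar G v)
    (hM : ∀ e ∈ M, e ∈ G.edgeSet) {u w : V} (hu : G.Adj v u) (huw : G.Adj u w) (hwv : w ≠ v)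
    (hv : s(u, v) ∉ M) : edgeDeg M u = M.count s(u, w) := by
  have := Fintype.ofFinite V
  rw [edgeDeg_eq_sum_count_of_nbr M hM u {v, w}, Finset.sum_pair hwv.symm,
    Multiset.count_eq_zero.2 hv, zero_add]
  intro i hi
  by_cases hiv : i = v
  · simp [hiv]
  · simp [h.unique u i w hu hi huw hiv hwv]

lemma edgeDeg_pendant_eq [Finite V] [DecidableEq V] {M : Multiset (Sym2 V)}
    (hM : ∀ e ∈ M, e ∈ G.edgeSet) {u w : V}
    (hw : ∀ z, G.Adj w z → z = u) : edgeDeg M w = M.count s(u, w) := by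
  have := Fintype.ofFinite V
  rw [edgeDeg_eq_sum_count_of_nbr M hM w {u} (by simpa using hw), Finset.sum_singleton,
    Sym2.eq_swap]

variable [Fintype V]

lemma exists_bipartition (h : IsExtendedStar G v) (hG : G.IsTree) :
    ∃ A : Finset V, (∀ z, z ∈ A ↔ G.Adj v z) ∧ ∀ a b, G.Adj a b → (a ∈ A ↔ b ∉ A) := by
  classical
  obtain ⟨K, hvK, hK⟩ := hG.exists_bipartition v
  refine ⟨Kᶜ, fun z => ?_, fun a b hab => by
    have := hK a b hab; simp only [Finset.mem_compl]; tauto⟩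
  rw [Finset.mem_compl]
  refine ⟨fun hz => ?_, fun hz => (hK _ _ hz).1 hvK⟩
  rcases h.cover z with rfl | h1 | ⟨u, h1, h2⟩
  · exact absurd hvK hz
  · exact h1
  · have h3 := hK _ _ h1
    have h4 := hK _ _ h2
    tauto

lemma exists_parent (h : IsExtendedStar G v) (hG : G.IsTree) {w : V} (hwv : w ≠ v)
    (hw : ¬ G.Adj v w) : ∃ u, G.Adj v u ∧ G.Adj u w ∧ ∀ z, G.Adj w z → z = u := by
  obtain ⟨A, hA, hA'⟩ := h.exists_bipartition hG
  rcases h.cover w with h1 | h1 | ⟨u, h1, h2⟩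
  · exact absurd h1 hwv
  · exact absurd h1 hw
  refine ⟨u, h1, h2, fun z hz => ?_⟩
  by_contra hzu
  have hvz : G.Adj v z := by
    rw [← hA]
    by_contra h3
    have := hA' _ _ hz
    rw [hA w] at this
    tauto
  obtain ⟨C, hvC, huC, hC⟩ := hG.exists_cut h1
  have hzC : z ∈ C := (hC _ _ hvz (by simp [hzu, h1.ne])).1 hvC
  have hwC : w ∈ C := (hC _ _ hz.symm (by simp [hzu, hvz.ne'])).1 hzC
  exact huC ((hC _ _ h2.symm (by simp [hwv, h2.ne'])).1 hwC)

variable [DecidableEq V] {c : V → ℕ} {M N : Multiset (Sym2 V)}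

lemma exists_unsaturated (h : IsExtendedStar G v) (hG : G.IsTree) (hM : IsMaxBMatching G c M)
    (hN : IsMaxBMatching G c N) {ρ : V} (hρ : G.Adj v ρ) (hlt : edgeDeg M ρ < c ρ) :
    ∃ u, G.Adj v u ∧ edgeDeg N u < c u := by
  by_contra! hall
  obtain ⟨A, hA, hA'⟩ := h.exists_bipartition hG
  have h1 := card_eq_sum_edgeDeg A hA' M hM.1.1
  have h2 := card_eq_sum_edgeDeg A hA' N hN.1.1
  have h3 : ∑ j ∈ A, edgeDeg M j < ∑ j ∈ A, c j :=
    Finset.sum_lt_sum (fun j _ => hM.1.2 j) ⟨ρ, (hA ρ).2 hρ, hlt⟩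
  have h4 : ∑ j ∈ A, c j ≤ ∑ j ∈ A, edgeDeg N j :=
    Finset.sum_le_sum fun j hj => hall j ((hA j).1 hj)
  have := hN.2 M hM.1
  have := hM.2 N hN.1
  omega

lemma not_lt_of_adj (h : IsExtendedStar G v) (hG : G.IsTree) (hM : IsMaxBMatching G c M)
    (hN : IsMaxBMatching G c N) {ρ w : V} (hρ : G.Adj v ρ) (hw : ¬ G.Adj v w)
    (hlt : edgeDeg M ρ < c ρ) : edgeDeg M w ≤ edgeDeg N w := by
  by_contra! hwlt
  have hwc : edgeDeg N w < c w := hwlt.trans_le (hM.1.2 w)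
  obtain ⟨u₀, hu₀, hu₀lt⟩ := h.exists_unsaturated hG hM hN hρ hlt
  by_cases hwv : w = v
  · subst hwv
    exact absurd (hN.le_of_adj hu₀ hwc) (by omega)
  obtain ⟨u, hu, huw, hunique⟩ := h.exists_parent hG hwv hw
  have huv : s(u, v) ∉ N := fun hmem => by
    have := hN.le_of_adj₃ huw.symm hmem hu₀ (by rintro rfl; exact hw hu₀) hwc
    omega
  have h1 := hN.le_of_adj huw.symm hwc
  have h2 := h.edgeDeg_parent_eq hN.1.1 hu huw hwv huv
  have h3 := IsExtendedStar.edgeDeg_pendant_eq hN.1.1 hunique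
  have h4 := IsExtendedStar.edgeDeg_pendant_eq hM.1.1 hunique
  have h5 := count_le_edgeDeg M u w
  have h6 := hM.1.2 u
  omega

lemma center_mem (h : IsExtendedStar G v) (hM : IsMaxBMatching G c M)
    (hN : IsMaxBMatching G c N) (hG : G.IsTree) {ξ : V} (hξ : G.Adj v ξ)
    (hlt : edgeDeg N ξ < edgeDeg M ξ) : s(v, ξ) ∈ M := by
  by_contra hmem
  have hmem' : s(ξ, v) ∉ M := by rwa [Sym2.eq_swap]
  have hpos : 0 < edgeDeg M ξ := by omega
  rw [edgeDeg_eq_sum_count M hM.1.1] at hpos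
  obtain ⟨w, -, hw⟩ := Finset.exists_ne_zero_of_sum_ne_zero hpos.ne'
  have hw : s(ξ, w) ∈ M := Multiset.count_ne_zero.1 hw
  have hξw : G.Adj ξ w := hM.1.1 _ hw
  have hwv : w ≠ v := by rintro rfl; exact hmem' hw
  have hvw : ¬ G.Adj v w := by
    obtain ⟨A, hA, hA'⟩ := h.exists_bipartition hG
    have := hA' _ _ hξw
    rw [hA, hA] at this
    tauto
  have h1 := h.edgeDeg_parent_eq hM.1.1 hξ hξw hwv hmem'
  have h2 := hN.le_of_adj hξw (hlt.trans_le (hM.1.2 ξ))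
  obtain ⟨u, -, huw, hunique⟩ := h.exists_parent hG hwv hvw
  obtain rfl := hunique ξ hξw.symm
  have h3 := IsExtendedStar.edgeDeg_pendant_eq hN.1.1 hunique
  have h4 := IsExtendedStar.edgeDeg_pendant_eq hM.1.1 hunique
  have h5 := count_le_edgeDeg N ξ w
  have h6 := hM.1.2 w
  omega

lemma parent_mem (h : IsExtendedStar G v) (hM : IsMaxBMatching G c M)
    (hN : IsMaxBMatching G c N) {u w : V} (hu : G.Adj v u) (huw : G.Adj u w) (hwv : w ≠ v)
    (hw : ∀ z, G.Adj w z → z = u) (hlt : edgeDeg M w < edgeDeg N w) : s(u, v) ∈ M := by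
  by_contra hmem
  have h1 := h.edgeDeg_parent_eq hM.1.1 hu huw hwv hmem
  have h2 := hM.le_of_adj huw.symm (hlt.trans_le (hN.1.2 w))
  have h3 := IsExtendedStar.edgeDeg_pendant_eq hN.1.1 hw
  have h4 := IsExtendedStar.edgeDeg_pendant_eq hM.1.1 hw
  have h5 := count_le_edgeDeg N u w
  have h6 := hN.1.2 u
  omega

end IsExtendedStar

lemma IsExtendedStar.SEP {n : ℕ} {G : SimpleGraph (Fin n)} {v : Fin n}
    (h : IsExtendedStar G v) (hG : G.IsTree) : SEP G := by
  intro c _ a ha b hb ξ ρ hξ hρ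
  obtain ⟨M, hM, rfl⟩ := (mem_genW_iff_s14 G c _).1 ha
  obtain ⟨N, hN, rfl⟩ := (mem_genW_iff_s14 G c _).1 hb
  have hne : ξ ≠ ρ := by rintro rfl; omega
  have hρc : edgeDeg M ρ < c ρ := hρ.trans_le (hN.1.2 ρ)
  have hξc : edgeDeg N ξ < c ξ := hξ.trans_le (hM.1.2 ξ)
  by_cases hρA : G.Adj v ρ
  · by_cases hξA : G.Adj v ξ
    · exact exch_mem_genW_of_adj₂ hM hρA.symm (h.center_mem hM hN hG hξA hξ) hne hρc
    · exact absurd (h.not_lt_of_adj hG hM hN hρA hξA hρc) (by omega)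
  by_cases hξA : G.Adj v ξ
  · exact absurd (h.not_lt_of_adj hG hN hM hξA hρA hξc) (by omega)
  have hmem : ∀ u, (∀ z, G.Adj ξ z → z = u) → s(u, ξ) ∈ M := fun u hu => by
    have := IsExtendedStar.edgeDeg_pendant_eq hM.1.1 hu
    exact Multiset.count_pos.1 (by omega)
  by_cases hρv : ρ = v
  · subst hρv
    obtain ⟨u, hu, huξ, hunique⟩ := h.exists_parent hG hne hξA
    exact exch_mem_genW_of_adj₂ hM hu (hmem u hunique) hne hρc
  obtain ⟨u, hu, huρ, hunique⟩ := h.exists_parent hG hρv hρA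
  have huv := h.parent_mem hM hN hu huρ hρv hunique hρ
  by_cases hξv : ξ = v
  · subst hξv
    exact exch_mem_genW_of_adj₂ hM huρ.symm huv hne hρc
  obtain ⟨u', hu', huξ, hunique'⟩ := h.exists_parent hG hξv hξA
  refine exch_mem_genW_of_adj₄ hM huρ.symm huv hu' (hmem u' hunique') ?_ hne hρc
  rw [Ne, Sym2.eq_iff]
  rintro (⟨-, h1⟩ | ⟨-, h1⟩)
  · exact hξv h1
  · exact hξA (h1 ▸ hu)

lemma edgeDeg_replicate {V : Type*} [DecidableEq V] (k : ℕ) (a b j : V) :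
    edgeDeg (Multiset.replicate k s(a, b)) j = if j = a ∨ j = b then k else 0 := by
  induction k with
  | zero => simp [edgeDeg]
  | succ k ih =>
    rw [Multiset.replicate_succ, edgeDeg, Multiset.countP_cons, ← edgeDeg, ih]
    split_ifs <;> simp_all

/-- `p` enumerates the vertices of `G` along a path with six vertices. -/
structure IsPathSix {V : Type*} (G : SimpleGraph V) (p : Fin 6 → V) : Prop where
  injective : Function.Injective p
  surjective : Function.Surjective p
  adj_iff : ∀ i j, G.Adj (p i) (p j) ↔ i.val + 1 = j.val ∨ j.val + 1 = i.val

namespace IsPathSix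

variable {V : Type*} {G : SimpleGraph V} {p : Fin 6 → V}

lemma eq_or (h : IsPathSix G p) (z : V) :
    z = p 0 ∨ z = p 1 ∨ z = p 2 ∨ z = p 3 ∨ z = p 4 ∨ z = p 5 := by
  obtain ⟨i, rfl⟩ := h.surjective z
  fin_cases i <;> simp

variable [DecidableEq V] [Fintype V] {c : V → ℕ} {M N : Multiset (Sym2 V)}

lemma edgeDeg_eq (h : IsPathSix G p) (hM : ∀ e ∈ M, e ∈ G.edgeSet) :
    edgeDeg M (p 0) = M.count s(p 0, p 1) ∧
    edgeDeg M (p 1) = M.count s(p 0, p 1) + M.count s(p 1, p 2) ∧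
    edgeDeg M (p 2) = M.count s(p 1, p 2) + M.count s(p 2, p 3) ∧
    edgeDeg M (p 3) = M.count s(p 2, p 3) + M.count s(p 3, p 4) ∧
    edgeDeg M (p 4) = M.count s(p 3, p 4) + M.count s(p 4, p 5) ∧
    edgeDeg M (p 5) = M.count s(p 4, p 5) := by
  have key : ∀ i, edgeDeg M (p i) = ∑ j, if i.val + 1 = j.val ∨ j.val + 1 = i.val then
      M.count s(p i, p j) else 0 := fun i => by
    rw [edgeDeg_eq_sum_count M hM, ← (Equiv.ofBijective p ⟨h.injective, h.surjective⟩).sum_comp]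
    refine Finset.sum_congr rfl fun j _ => ?_
    split_ifs with hij
    · rfl
    · rw [Multiset.count_eq_zero]
      exact fun hmem => hij ((h.adj_iff i j).1 (hM _ hmem))
  simp only [key, Fin.sum_univ_six]
  simp [Sym2.eq_swap (a := p 1) (b := p 0), Sym2.eq_swap (a := p 2) (b := p 1),
    Sym2.eq_swap (a := p 3) (b := p 2), Sym2.eq_swap (a := p 4) (b := p 3),
    Sym2.eq_swap (a := p 5) (b := p 4)]

lemma card_eq (h : IsPathSix G p) (hM : ∀ e ∈ M, e ∈ G.edgeSet) :
    M.card = M.count s(p 0, p 1) + M.count s(p 1, p 2) + M.count s(p 2, p 3) +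
      M.count s(p 3, p 4) + M.count s(p 4, p 5) := by
  have h1 := sum_edgeDeg M hM
  have h2 := h.edgeDeg_eq hM
  rw [← (Equiv.ofBijective p ⟨h.injective, h.surjective⟩).sum_comp, Fin.sum_univ_six] at h1
  change edgeDeg M (p 0) + edgeDeg M (p 1) + edgeDeg M (p 2) + edgeDeg M (p 3) + edgeDeg M (p 4) +
    edgeDeg M (p 5) = _ at h1
  omega

/-- König duality on the path with six vertices. -/
lemma exists_tight_cover (h : IsPathSix G p) (hM : IsMaxBMatching G c M) :
    M.card = c (p 1) + c (p 3) + c (p 5) ∨ M.card = c (p 0) + c (p 2) + c (p 4) ∨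
    M.card = c (p 1) + c (p 2) + c (p 4) ∨ M.card = c (p 1) + c (p 3) + c (p 4) ∨
    M.card = c (p 0) + c (p 2) + c (p 3) + c (p 5) := by
  have key : ∀ x₀ x₁ x₂ x₃ x₄ : ℕ, x₀ ≤ c (p 0) → x₀ + x₁ ≤ c (p 1) → x₁ + x₂ ≤ c (p 2) →
      x₂ + x₃ ≤ c (p 3) → x₃ + x₄ ≤ c (p 4) → x₄ ≤ c (p 5) →
      x₀ + x₁ + x₂ + x₃ + x₄ ≤ M.card := by
    intro x₀ x₁ x₂ x₃ x₄ h0 h1 h2 h3 h4 h5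
    have := hM.2 (.replicate x₀ s(p 0, p 1) + .replicate x₁ s(p 1, p 2) +
      .replicate x₂ s(p 2, p 3) + .replicate x₃ s(p 3, p 4) + .replicate x₄ s(p 4, p 5)) ⟨?_, ?_⟩
    · simpa using this
    · intro e he
      simp only [Multiset.mem_add, Multiset.mem_replicate] at he
      rcases he with (((⟨-, rfl⟩ | ⟨-, rfl⟩) | ⟨-, rfl⟩) | ⟨-, rfl⟩) | ⟨-, rfl⟩ <;>
        exact (h.adj_iff _ _).2 (by simp)
    · intro j
      simp only [edgeDeg_add, Pi.add_apply, edgeDeg_replicate]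
      rcases h.eq_or j with rfl | rfl | rfl | rfl | rfl | rfl <;>
        simp [h.injective.eq_iff] <;> omega
  have h1 := h.edgeDeg_eq hM.1.1
  have h2 := h.card_eq hM.1.1
  have b0 := hM.1.2 (p 0)
  have b1 := hM.1.2 (p 1)
  have b2 := hM.1.2 (p 2)
  have b3 := hM.1.2 (p 3)
  have b4 := hM.1.2 (p 4)
  have b5 := hM.1.2 (p 5)
  obtain ⟨x₀, hx₀⟩ : ∃ x, x = min (c (p 0)) (c (p 1)) := ⟨_, rfl⟩
  obtain ⟨x₁, hx₁⟩ : ∃ x, x = min (c (p 1) - x₀) (c (p 2)) := ⟨_, rfl⟩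
  obtain ⟨x₂, hx₂⟩ : ∃ x, x = min (c (p 2) - x₁) (c (p 3)) := ⟨_, rfl⟩
  obtain ⟨x₃, hx₃⟩ : ∃ x, x = min (c (p 3) - x₂) (c (p 4)) := ⟨_, rfl⟩
  obtain ⟨x₄, hx₄⟩ : ∃ x, x = min (c (p 4) - x₃) (c (p 5)) := ⟨_, rfl⟩
  have := key x₀ x₁ x₂ x₃ x₄ (by omega) (by omega) (by omega) (by omega) (by omega) (by omega)
  omega

end IsPathSix

set_option maxHeartbeats 1000000 in
lemma IsPathSix.SEP {n : ℕ} {G : SimpleGraph (Fin n)} {p : Fin 6 → Fin n}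
    (h : IsPathSix G p) : SEP G := by
  intro c _ a ha b hb ξ ρ hξ hρ
  obtain ⟨M, hM, rfl⟩ := (mem_genW_iff_s14 G c _).1 ha
  obtain ⟨N, hN, rfl⟩ := (mem_genW_iff_s14 G c _).1 hb
  have hcov := h.exists_tight_cover hM
  have hne : ξ ≠ ρ := by rintro rfl; omega
  have hρc : edgeDeg M ρ < c ρ := hρ.trans_le (hN.1.2 ρ)
  have hMN : N.card = M.card := le_antisymm (hM.2 N hN.1) (hN.2 M hM.1)
  have b0 := hM.1.2 (p 0)
  have b1 := hM.1.2 (p 1)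
  have b2 := hM.1.2 (p 2)
  have b3 := hM.1.2 (p 3)
  have b4 := hM.1.2 (p 4)
  have b5 := hM.1.2 (p 5)
  have b0' := hN.1.2 (p 0)
  have b1' := hN.1.2 (p 1)
  have b2' := hN.1.2 (p 2)
  have b3' := hN.1.2 (p 3)
  have b4' := hN.1.2 (p 4)
  have b5' := hN.1.2 (p 5)
  have hMc := h.card_eq hM.1.1
  have hNc := h.card_eq hN.1.1
  obtain ⟨d0, d1, d2, d3, d4, d5⟩ := h.edgeDeg_eq hM.1.1
  obtain ⟨d0', d1', d2', d3', d4', d5'⟩ := h.edgeDeg_eq hN.1.1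
  have e2 : ∀ i j k : Fin 6, ρ = p i → ξ = p k →
      ((i.val + 1 = j.val ∨ j.val + 1 = i.val) ∧ (j.val + 1 = k.val ∨ k.val + 1 = j.val)) →
      0 < M.count s(p j, p k) → exch (edgeDeg M) ξ ρ ∈ genW G c := by
    rintro i j k rfl rfl ⟨hij, -⟩ hpos
    exact exch_mem_genW_of_adj₂ hM ((h.adj_iff i j).2 hij) (Multiset.count_pos.1 hpos) hne hρc
  have e4 : ∀ i j k l m : Fin 6, ρ = p i → ξ = p m →
      ((i.val + 1 = j.val ∨ j.val + 1 = i.val) ∧ (k.val + 1 = l.val ∨ l.val + 1 = k.val) ∧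
        (l.val + 1 = m.val ∨ m.val + 1 = l.val) ∧ m ≠ j ∧ m ≠ k) →
      0 < M.count s(p j, p k) → 0 < M.count s(p l, p m) →
      exch (edgeDeg M) ξ ρ ∈ genW G c := by
    rintro i j k l m rfl rfl ⟨hij, hkl, -, hm⟩ hpos hpos'
    refine exch_mem_genW_of_adj₄ hM ((h.adj_iff i j).2 hij) (Multiset.count_pos.1 hpos)
      ((h.adj_iff k l).2 hkl) (Multiset.count_pos.1 hpos') ?_ hne hρc
    rw [Ne, Sym2.eq_iff, h.injective.eq_iff, h.injective.eq_iff, h.injective.eq_iff,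
      h.injective.eq_iff]
    tauto
  have s1 : M.count s(p 1, p 0) = M.count s(p 0, p 1) := by rw [Sym2.eq_swap]
  have s2 : M.count s(p 2, p 1) = M.count s(p 1, p 2) := by rw [Sym2.eq_swap]
  have s3 : M.count s(p 3, p 2) = M.count s(p 2, p 3) := by rw [Sym2.eq_swap]
  have s4 : M.count s(p 4, p 3) = M.count s(p 3, p 4) := by rw [Sym2.eq_swap]
  have s5 : M.count s(p 5, p 4) = M.count s(p 4, p 5) := by rw [Sym2.eq_swap]
  rcases h.eq_or ρ with hi | hi | hi | hi | hi | hi <;>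
  rcases h.eq_or ξ with hj | hj | hj | hj | hj | hj <;>
  rw [hi, hj] at hne <;> rw [hi] at hρ hρc <;> rw [hj] at hξ
  all_goals first
    | exact absurd rfl hne
    | (refine e2 _ 1 _ hi hj ?_ ?_; · decide
       omega)
    | (refine e2 _ 2 _ hi hj ?_ ?_; · decide
       omega)
    | (refine e2 _ 3 _ hi hj ?_ ?_; · decide
       omega)
    | (refine e2 _ 4 _ hi hj ?_ ?_; · decide
       omega)
    | (refine e4 _ 1 2 3 _ hi hj ?_ ?_ ?_; · decide
       all_goals omega)
    | (refine e4 _ 3 2 1 _ hi hj ?_ ?_ ?_; · decide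
       all_goals omega)
    | (refine e4 _ 2 3 4 _ hi hj ?_ ?_ ?_; · decide
       all_goals omega)
    | (refine e4 _ 4 3 2 _ hi hj ?_ ?_ ?_; · decide
       all_goals omega)
    | omega

namespace SimpleGraph

variable {V : Type*} {G : SimpleGraph V}

/-- A vertex set of a connected graph which is closed under adjacency is everything. -/
lemma Connected.mem_of_adj_closed (hG : G.Connected) {S : Set V} {v : V} (hv : v ∈ S)
    (hS : ∀ x y, x ∈ S → G.Adj x y → y ∈ S) (z : V) : z ∈ S := by
  obtain ⟨w⟩ := hG.preconnected v z
  induction w with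
  | nil => exact hv
  | cons h _ ih => exact ih (hS _ _ hv h)

lemma ncard_neighborSet_le_two {v x y : V} (h : ∀ z, G.Adj v z → z = x ∨ z = y) :
    (G.neighborSet v).ncard ≤ 2 :=
  (Set.ncard_le_ncard (t := {x, y}) (fun z hz => by simpa using h z hz)).trans
    (Set.ncard_insert_le x {y} |>.trans (by simp))

lemma eq_or_eq_of_ncard_neighborSet_le_two [Finite V] {v x y z : V}
    (h : (G.neighborSet v).ncard ≤ 2) (hx : G.Adj v x) (hy : G.Adj v y) (hxy : x ≠ y)
    (hz : G.Adj v z) : z = x ∨ z = y := by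
  by_contra! hne
  have h3 : 2 < (G.neighborSet v).ncard :=
    (Set.two_lt_ncard_iff (Set.toFinite _)).2 ⟨x, y, z, hx, hy, hz, hxy, hne.1.symm, hne.2.symm⟩
  omega

lemma Connected.dist_le_two_iff (hG : G.Connected) {v z : V} :
    G.dist v z ≤ 2 ↔ z = v ∨ G.Adj v z ∨ ∃ u, G.Adj v u ∧ G.Adj u z := by
  constructor
  · intro h
    obtain ⟨w, hw⟩ := hG.exists_walk_length_eq_dist v z
    rw [← hw] at h
    match w, h with
    | .nil, _ => exact .inl rfl
    | .cons h1 .nil, _ => exact .inr (.inl h1)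
    | .cons h1 (.cons h2 .nil), _ => exact .inr (.inr ⟨_, h1, h2⟩)
    | .cons _ (.cons _ (.cons _ _)), h => simp at h
  · rintro (rfl | h | ⟨u, h1, h2⟩)
    · simp
    · exact (dist_le (.cons h .nil)).trans (by simp)
    · exact dist_le (.cons h1 (.cons h2 .nil))

end SimpleGraph

lemma isExtendedStar_iff {V : Type*} [Finite V] {G : SimpleGraph V} (hG : G.Connected) {v : V} :
    IsExtendedStar G v ↔
      (∀ u, G.dist v u ≤ 2) ∧ ∀ u, G.Adj v u → (G.neighborSet u).ncard ≤ 2 := by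
  constructor
  · refine fun h => ⟨fun u => hG.dist_le_two_iff.2 (h.cover u), fun u hu => ?_⟩
    by_cases hx : ∃ x, G.Adj u x ∧ x ≠ v
    · obtain ⟨x, hx, hxv⟩ := hx
      refine SimpleGraph.ncard_neighborSet_le_two (x := v) (y := x) fun z hz => ?_
      by_contra! hne
      exact hne.2 (h.unique u z x hu hz hx hne.1 hxv)
    · push Not at hx
      exact SimpleGraph.ncard_neighborSet_le_two (x := v) (y := v) fun z hz => .inl (hx z hz)
  · refine fun h => ⟨fun z => hG.dist_le_two_iff.1 (h.1 z), fun u x y hu hx hy hxv hyv => ?_⟩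
    exact ((SimpleGraph.eq_or_eq_of_ncard_neighborSet_le_two (h.2 u hu) hu.symm hx hxv.symm
      hy).resolve_left hyv).symm

/-- If no walk of length three without backtracking starts at `v`, then every vertex is within
distance two of `v`. -/
lemma SimpleGraph.Connected.dist_le_two_of_no_chain {V : Type*} {G : SimpleGraph V}
    (hG : G.Connected) {v : V}
    (h : ∀ x y z, G.Adj v x → G.Adj x y → y ≠ v → G.Adj y z → z ≠ x → False) (z : V) :
    z = v ∨ G.Adj v z ∨ ∃ u, G.Adj v u ∧ G.Adj u z := by
  refine hG.mem_of_adj_closed (S := {z | z = v ∨ G.Adj v z ∨ ∃ u, G.Adj v u ∧ G.Adj u z})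
    (v := v) (.inl rfl) ?_ z
  rintro x y (rfl | hx | ⟨u, hu, hx⟩) hxy
  · exact .inr (.inl hxy)
  · exact .inr (.inr ⟨x, hx, hxy⟩)
  · by_cases hxv : x = v
    · exact .inr (.inl (hxv ▸ hxy))
    by_cases hyu : y = u
    · exact .inr (.inl (hyu ▸ hu))
    exact (h u x y hu hx hxv hxy hyu).elim

/-- The vertices `a`, `b`, `c`, `d`, `e`, `f` form a walk of length five without backtracking. -/
structure IsChainSix {V : Type*} (G : SimpleGraph V) (a b c d e f : V) : Prop where
  ab : G.Adj a b
  bc : G.Adj b c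
  cd : G.Adj c d
  de : G.Adj d e
  ef : G.Adj e f
  ac : a ≠ c
  bd : b ≠ d
  ce : c ≠ e
  df : d ≠ f

lemma IsChainSix.symm {V : Type*} {G : SimpleGraph V} {a b c d e f : V}
    (h : IsChainSix G a b c d e f) : IsChainSix G f e d c b a :=
  ⟨h.ef.symm, h.de.symm, h.cd.symm, h.bc.symm, h.ab.symm, h.df.symm, h.ce.symm, h.bd.symm,
    h.ac.symm⟩

/-- A connected graph without two forbidden local configurations contains a long walk without
backtracking or is an extended star. -/
lemma exists_isChainSix_or_isExtendedStar {V : Type*} {G : SimpleGraph V} (hG : G.Connected)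
    (h3 : ∀ u w₁ w₂ v u' w, G.Adj u w₁ → G.Adj u w₂ → w₁ ≠ w₂ → w₁ ≠ v → w₂ ≠ v → G.Adj u v →
      G.Adj v u' → u' ≠ u → G.Adj u' w → w ≠ v → False)
    (h4 : ∀ u v a b c d, G.Adj u v → G.Adj u a → G.Adj u b → a ≠ b → a ≠ v → b ≠ v →
      G.Adj v c → G.Adj v d → c ≠ d → c ≠ u → d ≠ u → False) :
    (∃ a b c d e f, IsChainSix G a b c d e f) ∨ ∃ v, IsExtendedStar G v := by
  by_cases c6 : ∃ a b c d e f, IsChainSix G a b c d e f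
  · exact .inl c6
  right
  by_cases c5 : ∃ a b c d e, G.Adj a b ∧ G.Adj b c ∧ G.Adj c d ∧ G.Adj d e ∧ a ≠ c ∧ b ≠ d ∧ c ≠ e
  · obtain ⟨a, b, c, d, e, ab, bc, cd, de, ac, bd, ce⟩ := c5
    refine ⟨c, hG.dist_le_two_of_no_chain fun x y z hx hy hyc hz hzx => c6 ?_,
      fun u x y hu hx hy hxc hyc => ?_⟩
    · by_cases hbx : b = x
      · exact ⟨e, d, c, x, y, z, de.symm, cd.symm, hx, hy, hz, ce.symm, hbx ▸ bd.symm, hyc.symm,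
          hzx.symm⟩
      · exact ⟨a, b, c, x, y, z, ab, bc, hx, hy, hz, ac, hbx, hyc.symm, hzx.symm⟩
    · by_contra hxy
      by_cases hbu : b = u
      · exact h3 u x y c d e hx hy hxy hxc hyc hu.symm cd (hbu ▸ bd.symm) de ce.symm
      · exact h3 u x y c b a hx hy hxy hxc hyc hu.symm bc.symm hbu ab.symm ac
  by_cases c4 : ∃ a b c d, G.Adj a b ∧ G.Adj b c ∧ G.Adj c d ∧ a ≠ c ∧ b ≠ d
  · have key : ∀ a b c d, G.Adj a b → G.Adj b c → G.Adj c d → a ≠ c → b ≠ d →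
        (∀ x y, G.Adj c x → G.Adj c y → x ≠ b → y ≠ b → x = y) → IsExtendedStar G b := by
      intro a b c d ab bc cd ac bd hc
      refine ⟨hG.dist_le_two_of_no_chain fun x y z hx hy hyb hz hzx => c5 ?_,
        fun u x y hu hx hy hxb hyb => ?_⟩
      · by_cases hax : a = x
        · exact ⟨d, c, b, x, y, cd.symm, bc.symm, hx, hy, bd.symm, hax ▸ ac.symm, hyb.symm⟩
        · exact ⟨a, b, x, y, z, ab, hx, hy, hz, hax, hyb.symm, hzx.symm⟩
      · by_cases huc : u = c
        · subst huc
          exact hc x y hx hy hxb hyb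
        · exact (c5 ⟨x, u, b, c, d, hx.symm, hu.symm, bc, cd, hxb, huc, bd⟩).elim
    obtain ⟨a, b, c, d, ab, bc, cd, ac, bd⟩ := c4
    by_cases hc : ∀ x y, G.Adj c x → G.Adj c y → x ≠ b → y ≠ b → x = y
    · exact ⟨b, key a b c d ab bc cd ac bd hc⟩
    · refine ⟨c, key d c b a cd.symm bc.symm ab.symm bd.symm ac.symm
        fun x y hx hy hxc hyc => ?_⟩
      push Not at hc
      obtain ⟨x', y', hx', hy', hxb', hyb', hxy'⟩ := hc
      by_contra hxy
      exact h4 b c x y x' y' bc hx hy hxy hxc hyc hx' hy' hxy' hxb' hyb'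
  by_cases c3 : ∃ a b c, G.Adj a b ∧ G.Adj b c ∧ a ≠ c
  · obtain ⟨a, b, c, ab, bc, ac⟩ := c3
    refine ⟨b, hG.dist_le_two_of_no_chain fun x y z hx hy hyb hz hzx =>
      c4 ⟨b, x, y, z, hx, hy, hz, hyb.symm, hzx.symm⟩, fun u x y hu hx hy hxb hyb => (c4 ?_).elim⟩
    by_cases hau : a = u
    · exact ⟨c, b, u, x, bc.symm, hu, hx, hau ▸ ac.symm, hxb.symm⟩
    · exact ⟨a, b, u, x, ab, hu, hx, hau, hxb.symm⟩
  · obtain ⟨v⟩ := hG.nonempty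
    exact ⟨v, hG.dist_le_two_of_no_chain fun x y z hx hy hyv _ _ =>
      c3 ⟨v, x, y, hx, hy, hyv.symm⟩, fun u x y hu hx hy hxv _ =>
      (c3 ⟨v, u, x, hu, hx, hxv.symm⟩).elim⟩

namespace IsChainSix

variable {n : ℕ} {G : SimpleGraph (Fin n)} {a b c d e f : Fin n}

/-- The middle edge of the walk is the only edge between its two halves. -/
lemma exists_cut (h : IsChainSix G a b c d e f) (hG : G.IsTree) :
    ∃ C : Finset (Fin n), a ∈ C ∧ b ∈ C ∧ c ∈ C ∧ d ∉ C ∧ e ∉ C ∧ f ∉ C ∧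
      ∀ x y, G.Adj x y → s(x, y) ≠ s(c, d) → (x ∈ C ↔ y ∈ C) := by
  obtain ⟨C, hc, hd, hC⟩ := hG.exists_cut h.cd
  have hb : b ∈ C := (hC b c h.bc (by simp [h.bd, h.bc.ne])).2 hc
  have ha : a ∈ C := (hC a b h.ab (by simp [h.ac, h.bc.ne])).2 hb
  have he : e ∉ C := fun he => hd ((hC d e h.de (by simp [h.cd.ne', h.ce.symm])).2 he)
  have hf : f ∉ C := fun hf => he ((hC e f h.ef (by simp [h.de.ne', h.ce.symm])).2 hf)
  exact ⟨C, ha, hb, hc, hd, he, hf, hC⟩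

lemma injective (h : IsChainSix G a b c d e f) (hG : G.IsTree) :
    Function.Injective ![a, b, c, d, e, f] := by
  obtain ⟨C, ha, hb, hc, hd, he, hf, -⟩ := h.exists_cut hG
  have hne : ∀ {x y}, x ∈ C → y ∉ C → x ≠ y := fun hx hy hxy => hy (hxy ▸ hx)
  have ab := h.ab.ne
  have bc := h.bc.ne
  have de := h.de.ne
  have ef := h.ef.ne
  have ac := h.ac
  have df := h.df
  have := hne ha hd
  have := hne ha he
  have := hne ha hf
  have := hne hb hd
  have := hne hb he
  have := hne hb hf
  have := hne hc hd
  have := hne hc he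
  have := hne hc hf
  intro i j hij
  fin_cases i <;> fin_cases j <;> simp_all

lemma isPathSix (h : IsChainSix G a b c d e f) (hG : G.IsTree) (hn : n = 6)
    (hdeg : ∀ v, (G.neighborSet v).ncard ≤ 2) : IsPathSix G ![a, b, c, d, e, f] := by
  have hinj := h.injective hG
  refine ⟨hinj, ((Fintype.bijective_iff_injective_and_card _).2 ⟨hinj, by simp [hn]⟩).2, ?_⟩
  have hb : ∀ z, G.Adj b z → z = a ∨ z = c := fun z hz =>
    SimpleGraph.eq_or_eq_of_ncard_neighborSet_le_two (hdeg b) h.ab.symm h.bc h.ac hz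
  have hc : ∀ z, G.Adj c z → z = b ∨ z = d := fun z hz =>
    SimpleGraph.eq_or_eq_of_ncard_neighborSet_le_two (hdeg c) h.bc.symm h.cd h.bd hz
  have hd : ∀ z, G.Adj d z → z = c ∨ z = e := fun z hz =>
    SimpleGraph.eq_or_eq_of_ncard_neighborSet_le_two (hdeg d) h.cd.symm h.de h.ce hz
  have he : ∀ z, G.Adj e z → z = d ∨ z = f := fun z hz =>
    SimpleGraph.eq_or_eq_of_ncard_neighborSet_le_two (hdeg e) h.de.symm h.ef h.df hz
  have haf : ¬ G.Adj a f := by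
    obtain ⟨C, ha, -, hc', hd', -, hf, hC⟩ := h.exists_cut hG
    exact fun haf => hf ((hC a f haf (by
      rw [Ne, Sym2.eq_iff]
      rintro (⟨had, -⟩ | ⟨had, -⟩)
      exacts [h.ac had, hd' (had ▸ ha)])).1 ha)
  have hb' : ∀ j, G.Adj b (![a, b, c, d, e, f] j) → j = 0 ∨ j = 2 :=
    fun j hj => (hb _ hj).imp (@hinj j 0 ·) (@hinj j 2 ·)
  have hc' : ∀ j, G.Adj c (![a, b, c, d, e, f] j) → j = 1 ∨ j = 3 :=
    fun j hj => (hc _ hj).imp (@hinj j 1 ·) (@hinj j 3 ·)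
  have hd' : ∀ j, G.Adj d (![a, b, c, d, e, f] j) → j = 2 ∨ j = 4 :=
    fun j hj => (hd _ hj).imp (@hinj j 2 ·) (@hinj j 4 ·)
  have he' : ∀ j, G.Adj e (![a, b, c, d, e, f] j) → j = 3 ∨ j = 5 :=
    fun j hj => (he _ hj).imp (@hinj j 3 ·) (@hinj j 5 ·)
  intro i j
  refine ⟨fun hij => ?_, ?_⟩
  · fin_cases i
    · fin_cases j
      exacts [(hij.ne rfl).elim, by decide, absurd (hc' 0 hij.symm) (by decide),
        absurd (hd' 0 hij.symm) (by decide), absurd (he' 0 hij.symm) (by decide), (haf hij).elim]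
    · rcases hb' j hij with rfl | rfl <;> decide
    · rcases hc' j hij with rfl | rfl <;> decide
    · rcases hd' j hij with rfl | rfl <;> decide
    · rcases he' j hij with rfl | rfl <;> decide
    · fin_cases j
      exacts [(haf hij.symm).elim, absurd (hb' 5 hij.symm) (by decide),
        absurd (hc' 5 hij.symm) (by decide), absurd (hd' 5 hij.symm) (by decide), by decide,
        (hij.ne rfl).elim]
  · have hp : ∀ i : Fin 5, G.Adj (![a, b, c, d, e, f] i.castSucc) (![a, b, c, d, e, f] i.succ) := by
      intro i
      fin_cases i
      exacts [h.ab, h.bc, h.cd, h.de, h.ef]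
    have hp' : ∀ i j : Fin 6, i.val + 1 = j.val →
        G.Adj (![a, b, c, d, e, f] i) (![a, b, c, d, e, f] j) := by
      intro i j hij
      have hi : i.val < 5 := by omega
      rw [show j = (⟨i, hi⟩ : Fin 5).succ from Fin.ext hij.symm]
      exact hp ⟨i, hi⟩
    rintro (hij | hij)
    exacts [hp' i j hij, (hp' j i hij).symm]

/-- If the walk cannot branch off or be extended, then it is the whole tree. -/
lemma eq_six (h : IsChainSix G a b c d e f) (hG : G.IsTree)
    (h3 : ∀ u w₁ w₂ v u' w, G.Adj u w₁ → G.Adj u w₂ → w₁ ≠ w₂ → w₁ ≠ v → w₂ ≠ v → G.Adj u v →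
      G.Adj v u' → u' ≠ u → G.Adj u' w → w ≠ v → False)
    (h7 : ∀ x a b c d e f, IsChainSix G a b c d e f → G.Adj x a → x ≠ b → False) :
    n = 6 ∧ ∀ v, (G.neighborSet v).ncard ≤ 2 := by
  have key1 : ∀ {a b c d e f}, IsChainSix G a b c d e f → ∀ z, G.Adj a z → z = b ∨ z = b :=
    fun h z hz => .inl (by_contra fun hne => h7 _ _ _ _ _ _ _ h hz.symm hne)
  have key2 : ∀ {a b c d e f}, IsChainSix G a b c d e f → ∀ z, G.Adj b z → z = a ∨ z = c := by
    intro a b c d e f h z hz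
    by_contra! hne
    exact h3 b a z c d e h.ab.symm hz hne.1.symm h.ac hne.2 h.bc h.cd h.bd.symm h.de h.ce.symm
  have key3 : ∀ {a b c d e f}, IsChainSix G a b c d e f → ∀ z, G.Adj c z → z = b ∨ z = d := by
    intro a b c d e f h z hz
    by_contra! hne
    exact h3 c b z d e f h.bc.symm hz hne.1.symm h.bd hne.2 h.cd h.de h.ce.symm h.ef h.df.symm
  have hall : ∀ z, z = a ∨ z = b ∨ z = c ∨ z = d ∨ z = e ∨ z = f := by
    refine hG.connected.mem_of_adj_closed
      (S := {z | z = a ∨ z = b ∨ z = c ∨ z = d ∨ z = e ∨ z = f}) (v := a) (.inl rfl) ?_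
    rintro x y (rfl | rfl | rfl | rfl | rfl | rfl) hxy
    · have := key1 h y hxy
      simp only [Set.mem_ofPred_eq]; tauto
    · have := key2 h y hxy
      simp only [Set.mem_ofPred_eq]; tauto
    · have := key3 h y hxy
      simp only [Set.mem_ofPred_eq]; tauto
    · have := key3 h.symm y hxy
      simp only [Set.mem_ofPred_eq]; tauto
    · have := key2 h.symm y hxy
      simp only [Set.mem_ofPred_eq]; tauto
    · have := key1 h.symm y hxy
      simp only [Set.mem_ofPred_eq]; tauto
  have hsurj : Function.Surjective ![a, b, c, d, e, f] := fun z => by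
    rcases hall z with rfl | rfl | rfl | rfl | rfl | rfl
    exacts [⟨0, rfl⟩, ⟨1, rfl⟩, ⟨2, rfl⟩, ⟨3, rfl⟩, ⟨4, rfl⟩, ⟨5, rfl⟩]
  refine ⟨by simpa using (Fintype.card_of_bijective ⟨h.injective hG, hsurj⟩).symm, fun v => ?_⟩
  rcases hall v with rfl | rfl | rfl | rfl | rfl | rfl
  exacts [SimpleGraph.ncard_neighborSet_le_two (key1 h),
    SimpleGraph.ncard_neighborSet_le_two (key2 h), SimpleGraph.ncard_neighborSet_le_two (key3 h),
    SimpleGraph.ncard_neighborSet_le_two (key3 h.symm),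
    SimpleGraph.ncard_neighborSet_le_two (key2 h.symm),
    SimpleGraph.ncard_neighborSet_le_two (key1 h.symm)]

end IsChainSix

/-- A tree `G` (on at least two vertices) enjoys the strong exchange
property iff either (i) `G` is the path `P₆` (a tree on 6 vertices all of whose degrees
are at most 2), or (ii) `G` is obtained from a star graph by attaching at most one
pendant edge to each of its leaves (there is a center `v₀` with every vertex at distance
at most 2 from `v₀` and every neighbor of `v₀` of degree at most 2). -/
theorem stmt14 (m : ℕ) (G : SimpleGraph (Fin m)) (htree : G.IsTree) (hm : 2 ≤ m) :
    SEP G ↔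
      ((m = 6 ∧ ∀ v, (G.neighborSet v).ncard ≤ 2) ∨
       (∃ v₀ : Fin m, (∀ u, G.dist v₀ u ≤ 2) ∧
          ∀ u, G.Adj v₀ u → (G.neighborSet u).ncard ≤ 2)) := by
  constructor
  · intro hS
    have h3 : ∀ u w₁ w₂ v u' w, G.Adj u w₁ → G.Adj u w₂ → w₁ ≠ w₂ → w₁ ≠ v → w₂ ≠ v →
        G.Adj u v → G.Adj v u' → u' ≠ u → G.Adj u' w → w ≠ v → False :=
      fun u w₁ w₂ v u' w h1 h2 h12 h1v h2v huv hvu' hu' hu'w hw =>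
        not_SEP_of_degree_three htree h1 h2 h12 h1v h2v huv hvu' hu' hu'w hw hS
    obtain ⟨a, b, c, d, e, f, h⟩ | ⟨v, hv⟩ := exists_isChainSix_or_isExtendedStar htree.connected h3
      fun u v a b c d huv ha hb hab hav hbv hc hd hcd hcu hdu =>
        not_SEP_of_adj_degree_three htree huv ha hb hab hav hbv hc hd hcd hcu hdu hS
    · refine .inl (h.eq_six htree h3 fun x a b c d e f h hxa hxb => ?_)
      refine not_SEP_of_path_seven htree (p := ![x, a, b, c, d, e, f]) (fun i => ?_) (fun i => ?_) hS
      · fin_cases i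
        exacts [hxa, h.ab, h.bc, h.cd, h.de, h.ef]
      · fin_cases i
        exacts [hxb, h.ac, h.bd, h.ce, h.df]
    · exact .inr ⟨v, (isExtendedStar_iff htree.connected).1 hv⟩
  · rintro (⟨h6, hdeg⟩ | ⟨v, hv⟩)
    · have hdeg' : ∀ {u x y z}, G.Adj u x → G.Adj u y → x ≠ y → x ≠ z → y ≠ z → ¬ G.Adj u z :=
        fun hx hy hxy hxz hyz hz =>
          (SimpleGraph.eq_or_eq_of_ncard_neighborSet_le_two (hdeg _) hx hy hxy hz).elim
            hxz.symm hyz.symm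
      obtain ⟨a, b, c, d, e, f, h⟩ | ⟨v, hv⟩ := exists_isChainSix_or_isExtendedStar htree.connected
        (fun _ _ _ _ _ _ h1 h2 h12 h1v h2v huv _ _ _ _ => hdeg' h1 h2 h12 h1v h2v huv)
        (fun _ _ _ _ _ _ huv ha hb hab hav hbv _ _ _ _ _ => hdeg' ha hb hab hav hbv huv)
      · exact (h.isPathSix htree h6 hdeg).SEP
      · exact hv.SEP htree
    · exact ((isExtendedStar_iff htree.connected).2 hv).SEP htree
end
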